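/- arXiv:2108.10412 — 2 statements merged into one kernel-verified Lean document; each statement's English description precedes it below -/
import Mathlib

section
/- (Weighted Bernstein inequality for J^s composed with S_k) Let n ≥ 1, s > 0, p ∈ [1,∞], and a ≥ 0. Then there exists C > 0, depending only on n, a, p, s and Φ, such that for every k ∈ ℕ and every f ∈ 𝒮(ℝⁿ): ‖S_k (J^{s} f)‖_{L^p_{⟨x⟩^a}} ≤ C 2^{ks} ‖f‖_{L^p_{⟨x⟩^a}}. -/
open MeasureTheory Real Complex
open scoped ENNReal NNReal RealInnerProductSpace

noncomputable section

abbrev Eu (n : ℕ) := EuclideanSpace ℝ (Fin n)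

/-- The polynomial weight `⟨x⟩^a = (1+|x|²)^{a/2}` as an `ℝ≥0∞`-valued function. -/
def jweight {n : ℕ} (a : ℝ) (x : Eu n) : ℝ≥0∞ :=
  ENNReal.ofReal ((1 + ‖x‖ ^ 2) ^ (a / 2))

/-- Weighted Lebesgue (quasi-)norm `‖f‖_{L^p_{⟨x⟩^a}}`; for `p = ∞` the essential sup norm. -/
def wNorm {n : ℕ} {F : Type*} [NormedAddCommGroup F] (p : ℝ≥0∞) (a : ℝ)
    (f : Eu n → F) : ℝ≥0∞ :=
  if p = ∞ then essSup (fun x => (‖f x‖₊ : ℝ≥0∞)) volume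
  else (∫⁻ x, (‖f x‖₊ : ℝ≥0∞) ^ p.toReal * jweight a x) ^ (1 / p.toReal)

/-- The Fourier transform `f̂(ξ) = ∫ f(x) e^{-i x·ξ} dx`. -/
def FT {n : ℕ} (f : Eu n → ℂ) (ξ : Eu n) : ℂ :=
  ∫ x, f x * Complex.exp (-(Complex.I * ((⟪x, ξ⟫ : ℝ) : ℂ)))

/-- The inhomogeneous fractional derivative (Bessel potential) `J^s`. -/
def Js {n : ℕ} (s : ℝ) (f : Eu n → ℂ) (x : Eu n) : ℂ :=
  ((((2 * Real.pi) ^ n)⁻¹ : ℝ) : ℂ) *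
    ∫ ξ, (((1 + ‖ξ‖ ^ 2) ^ (s / 2) : ℝ) : ℂ) * FT f ξ *
      Complex.exp (Complex.I * ((⟪x, ξ⟫ : ℝ) : ℂ))

/-- A Littlewood–Paley bump: `Φ ∈ C_c^∞(ℝⁿ)` with `0 ≤ Φ ≤ 1`, `Φ = 1` on `|ξ| ≤ 1` and
`Φ = 0` on `|ξ| ≥ 2`. -/
def IsLPBump {n : ℕ} (Φ : Eu n → ℝ) : Prop :=
  ContDiff ℝ (⊤ : ℕ∞) Φ ∧ (∀ ξ, 0 ≤ Φ ξ ∧ Φ ξ ≤ 1) ∧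
    (∀ ξ, ‖ξ‖ ≤ 1 → Φ ξ = 1) ∧ (∀ ξ, 2 ≤ ‖ξ‖ → Φ ξ = 0)

/-- The low-frequency projection `S_k f`, with Fourier multiplier `Φ(2^{-k}ξ)`. -/
def SProj {n : ℕ} (Φ : Eu n → ℝ) (k : ℤ) (f : Eu n → ℂ) (x : Eu n) : ℂ :=
  ((((2 * Real.pi) ^ n)⁻¹ : ℝ) : ℂ) *
    ∫ ξ, ((Φ ((2 : ℝ) ^ (-k) • ξ) : ℝ) : ℂ) * FT f ξ *
      Complex.exp (Complex.I * ((⟪x, ξ⟫ : ℝ) : ℂ))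

/-- The Littlewood–Paley piece `Δ_k f = S_k f - S_{k-1} f`, with Fourier multiplier
`Ψ(2^{-k}ξ) = Φ(2^{-k}ξ) - Φ(2^{-(k-1)}ξ)`. -/
def DProj {n : ℕ} (Φ : Eu n → ℝ) (k : ℤ) (f : Eu n → ℂ) (x : Eu n) : ℂ :=
  SProj Φ k f x - SProj Φ (k - 1) f x

open scoped FourierTransform SchwartzMap

lemma wb_FT_eq {n : ℕ} (f : Eu n → ℂ) (ξ : Eu n) : FT f ξ = 𝓕 f ((2 * π)⁻¹ • ξ) := by
  rw [Real.fourier_eq', FT]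
  congr 1
  ext v
  rw [smul_eq_mul, mul_comm, inner_smul_right]
  congr 2
  have : (2 * π : ℝ) ≠ 0 := by positivity
  have h2 : -2 * π * ((2 * π)⁻¹ * ⟪v, ξ⟫) = - ⟪v, ξ⟫ := by
    field_simp
  rw [h2]
  push_cast
  ring

lemma wb_inv_eq {n : ℕ} (F : Eu n → ℂ) (x : Eu n) :
    ((((2 * Real.pi) ^ n)⁻¹ : ℝ) : ℂ) *
    ∫ ξ, F ξ * Complex.exp (Complex.I * ((⟪x, ξ⟫ : ℝ) : ℂ)) =
    𝓕⁻ (fun η => F ((2 * π) • η)) x := by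
  rw [Real.fourierInv_eq']
  have := Measure.integral_comp_smul (volume : Measure (Eu n))
    (fun ξ => F ξ * Complex.exp (Complex.I * ((⟪x, ξ⟫ : ℝ) : ℂ))) (2 * π)
  rw [abs_of_nonneg (by positivity), finrank_euclideanSpace_fin, Complex.real_smul] at this
  rw [← this]
  congr 1
  ext v
  rw [smul_eq_mul, mul_comm, inner_smul_right, real_inner_comm]
  congr 2
  push_cast
  ring

lemma wb_two_pi_smul {n : ℕ} (ξ : Eu n) : (2 * π)⁻¹ • ((2 * π) • ξ) = ξ := by
  rw [inv_smul_smul₀ (by positivity)]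

lemma wb_SProj_eq {n : ℕ} (Φ : Eu n → ℝ) (k : ℤ) (g : Eu n → ℂ) (x : Eu n) :
    SProj Φ k g x = 𝓕⁻ (fun η => ((Φ ((2 : ℝ) ^ (-k) • ((2 * π) • η)) : ℝ) : ℂ) * 𝓕 g η) x := by
  rw [SProj, wb_inv_eq]
  simp only [wb_FT_eq, wb_two_pi_smul]

lemma wb_Js_eq {n : ℕ} (s : ℝ) (g : Eu n → ℂ) :
    Js s g = 𝓕⁻ (fun η => (((1 + ‖(2 * π) • η‖ ^ 2) ^ (s / 2) : ℝ) : ℂ) * 𝓕 g η) := by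
  ext x
  rw [Js, wb_inv_eq]
  simp only [wb_FT_eq, wb_two_pi_smul]

lemma wb_tg {n : ℕ} (s : ℝ) : (fun η : Eu n =>
    (((1 + ‖(2 * π) • η‖ ^ 2) ^ (s / 2) : ℝ) : ℂ)).HasTemperateGrowth := by
  have h := Function.hasTemperateGrowth_one_add_norm_sq_rpow (Eu n) (s / 2)
  have h1 : (fun η : Eu n => (2 * π) • η).HasTemperateGrowth := by
    fun_prop
  have h2 := h.comp h1
  exact (Complex.ofRealCLM.hasTemperateGrowth).comp h2

/-- the multiplier -/
def wbM {n : ℕ} (s : ℝ) (Φ : Eu n → ℝ) (k : ℕ) (η : Eu n) : ℂ :=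
  ((Φ ((2 : ℝ) ^ (-(k : ℤ)) • ((2 * π) • η)) : ℝ) : ℂ) *
    (((1 + ‖(2 * π) • η‖ ^ 2) ^ (s / 2) : ℝ) : ℂ)

lemma wb_comp {n : ℕ} (s : ℝ) (Φ : Eu n → ℝ) (k : ℕ) (f : 𝓢(Eu n, ℂ)) (x : Eu n) :
    SProj Φ (k : ℤ) (Js s ⇑f) x = 𝓕⁻ (fun η => wbM s Φ k η * 𝓕 (⇑f) η) x := by
  have hJ : Js s ⇑f = ⇑(𝓕⁻ (SchwartzMap.smulLeftCLM ℂ (fun η : Eu n =>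
    (((1 + ‖(2 * π) • η‖ ^ 2) ^ (s / 2) : ℝ) : ℂ)) (𝓕 f)) : 𝓢(Eu n, ℂ)) := by
    rw [wb_Js_eq, SchwartzMap.fourierInv_coe, SchwartzMap.smulLeftCLM_apply (wb_tg s)]
    rfl
  rw [wb_SProj_eq, hJ, ← SchwartzMap.fourier_coe, FourierTransform.fourier_fourierInv_eq,
    SchwartzMap.smulLeftCLM_apply (wb_tg s)]
  simp only [wbM, smul_eq_mul, mul_assoc]
  rfl

lemma wb_conv {n : ℕ} (M f : Eu n → ℂ) (hM : Integrable M) (hf : Integrable f) (x : Eu n) :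
    𝓕⁻ (fun η => M η * 𝓕 f η) x = ∫ y, f y * 𝓕⁻ M (x - y) := by
  rw [Real.fourierInv_eq]
  have hg : Integrable (fun η : Eu n => 𝐞 (⟪η, x⟫ : ℝ) • M η) := by
    simpa using (Real.fourierIntegral_convergent_iff (V := Eu n) (f := M) (-x)).2 hM
  have := VectorFourier.integral_fourierIntegral_smul_eq_flip (L := innerₗ (Eu n))
      (μ := volume) (ν := volume) Real.continuous_fourierChar continuous_inner hf hg
  have e1 : ∀ v, 𝐞 (⟪v, x⟫ : ℝ) • (M v * 𝓕 f v) =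
      (VectorFourier.fourierIntegral 𝐞 volume (innerₗ (Eu n)) f v) • (𝐞 (⟪v, x⟫ : ℝ) • M v) := by
    intro v
    change _ = 𝓕 f v • _
    simp only [Circle.smul_def, smul_eq_mul]
    ring
  simp_rw [e1]
  rw [this]
  congr 1
  ext y
  rw [smul_eq_mul, Real.fourierInv_eq]
  congr 1
  rw [VectorFourier.fourierIntegral]
  congr 1
  ext v
  rw [smul_smul, ← AddChar.map_add_eq_mul]
  congr 2
  simp [inner_sub_right, real_inner_comm]
  ring_nf

/-- weighted L1 norm of the kernel -/
def wbW {n : ℕ} (a : ℝ) (A : Eu n → ℂ) : ℝ≥0∞ := ∫⁻ y, ‖A y‖ₑ * jweight a y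

lemma wb_jweight_meas {n : ℕ} (a : ℝ) : Measurable (jweight (n := n) a) := by
  unfold jweight
  fun_prop

lemma wb_one_le_jweight {n : ℕ} {a : ℝ} (ha : 0 ≤ a) (x : Eu n) : 1 ≤ jweight a x := by
  unfold jweight
  rw [← ENNReal.ofReal_one]
  apply ENNReal.ofReal_le_ofReal
  apply Real.one_le_rpow _ (by positivity)
  nlinarith [sq_nonneg ‖x‖]

lemma wb_peetre {n : ℕ} {a : ℝ} (ha : 0 ≤ a) (x y : Eu n) :
    jweight a x ≤ ENNReal.ofReal (2 ^ (a / 2)) * (jweight a (x - y) * jweight a y) := by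
  unfold jweight
  rw [← ENNReal.ofReal_mul (by positivity), ← ENNReal.ofReal_mul (by positivity)]
  apply ENNReal.ofReal_le_ofReal
  rw [← Real.mul_rpow (by positivity) (by positivity),
    ← Real.mul_rpow (by positivity) (by positivity)]
  apply Real.rpow_le_rpow (by positivity) _ (by positivity)
  have h : ‖x‖ ≤ ‖x - y‖ + ‖y‖ := by simpa using norm_add_le (x - y) y
  have h1 := norm_nonneg x
  have h2 : ‖x‖ ^ 2 ≤ (‖x - y‖ + ‖y‖) ^ 2 := by gcongr
  nlinarith [sq_nonneg (‖x - y‖ - ‖y‖), sq_nonneg (‖x - y‖ * ‖y‖)]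

lemma wb_int_le_W {n : ℕ} {a : ℝ} (ha : 0 ≤ a) (A : Eu n → ℂ) : ∫⁻ y, ‖A y‖ₑ ≤ wbW a A := by
  unfold wbW
  gcongr with y
  exact le_mul_of_one_le_right' (wb_one_le_jweight ha y)

lemma wb_young {n : ℕ} (p : ℝ≥0∞) (hp : 1 ≤ p) {a : ℝ} (ha : 0 ≤ a)
    (A f g : Eu n → ℂ) (hA : Continuous A) (hf : Continuous f)
    (hg : ∀ x, ‖g x‖ₑ ≤ ∫⁻ y, ‖f y‖ₑ * ‖A (x - y)‖ₑ) :
    wNorm p a g ≤ ENNReal.ofReal (2 ^ (a / 2)) * wbW a A * wNorm p a f := by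
  have hAm := hA.measurable
  have hfm := hf.measurable
  have hc1 : (1 : ℝ≥0∞) ≤ ENNReal.ofReal (2 ^ (a / 2)) := by
    rw [← ENNReal.ofReal_one]
    exact ENNReal.ofReal_le_ofReal (Real.one_le_rpow (by norm_num) (by positivity))
  have hI : ∀ x, ∫⁻ y, ‖A (x - y)‖ₑ = ∫⁻ y, ‖A y‖ₑ := fun x =>
    lintegral_sub_left_eq_self (fun y => ‖A y‖ₑ) x
  unfold wNorm
  split_ifs with h
  · refine essSup_le_of_ae_le _ ?_
    filter_upwards with x
    change ‖g x‖ₑ ≤ _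
    refine (hg x).trans ?_
    have : ∀ᵐ y, ‖f y‖ₑ ≤ essSup (fun x => (‖f x‖₊ : ℝ≥0∞)) volume := ENNReal.ae_le_essSup _
    calc ∫⁻ y, ‖f y‖ₑ * ‖A (x - y)‖ₑ
        ≤ ∫⁻ y, essSup (fun x => (‖f x‖₊ : ℝ≥0∞)) volume * ‖A (x - y)‖ₑ := by
          apply lintegral_mono_ae
          filter_upwards [this] with y hy
          gcongr
      _ = essSup (fun x => (‖f x‖₊ : ℝ≥0∞)) volume * ∫⁻ y, ‖A y‖ₑ := by
          rw [lintegral_const_mul _ (by fun_prop), hI]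
      _ ≤ _ := by
          rw [mul_comm]
          gcongr
          calc _ ≤ wbW a A := wb_int_le_W ha A
            _ ≤ _ := le_mul_of_one_le_left' hc1
  · set q := p.toReal with hq
    have hq1 : 1 ≤ q := by
      rw [hq, ← ENNReal.toReal_one]
      exact ENNReal.toReal_mono h hp
    have hq0 : 0 < q := by linarith
    set I := ∫⁻ y, ‖A y‖ₑ with hIdef
    set c := ENNReal.ofReal (2 ^ (a / 2)) with hc
    have step1 : ∀ x, ‖g x‖ₑ ^ q ≤ I ^ (q - 1) * ∫⁻ y, ‖A (x - y)‖ₑ * ‖f y‖ₑ ^ q := by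
      intro x
      have H := ENNReal.lintegral_mul_norm_pow_le (μ := (volume : Measure (Eu n)))
        (f := fun y => ‖A (x - y)‖ₑ) (g := fun y => ‖A (x - y)‖ₑ * ‖f y‖ₑ ^ q)
        (p := 1 - 1 / q) (q := 1 / q) (by fun_prop) (by fun_prop)
        (by rw [sub_nonneg, div_le_one hq0]; exact hq1) (by positivity) (by ring)
      have e : ∀ y, ‖A (x - y)‖ₑ ^ (1 - 1 / q) * (‖A (x - y)‖ₑ * ‖f y‖ₑ ^ q) ^ (1 / q)
          = ‖f y‖ₑ * ‖A (x - y)‖ₑ := by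
        intro y
        rw [ENNReal.mul_rpow_of_nonneg _ _ (by positivity), ← ENNReal.rpow_mul,
          mul_one_div_cancel hq0.ne', ENNReal.rpow_one, ← mul_assoc,
          ← ENNReal.rpow_add_of_nonneg _ _
            (by rw [sub_nonneg, div_le_one hq0]; exact hq1) (by positivity)]
        simp [mul_comm]
      simp_rw [e] at H
      rw [hI] at H
      calc ‖g x‖ₑ ^ q ≤ (I ^ (1 - 1 / q) * (∫⁻ y, ‖A (x - y)‖ₑ * ‖f y‖ₑ ^ q) ^ (1 / q)) ^ q := by
            gcongr
            exact (hg x).trans H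
        _ = _ := by
            rw [ENNReal.mul_rpow_of_nonneg _ _ hq0.le, ← ENNReal.rpow_mul, ← ENNReal.rpow_mul,
              one_div_mul_cancel hq0.ne', ENNReal.rpow_one]
            congr 2
            field_simp
    have step2 : ∫⁻ x, (‖g x‖₊ : ℝ≥0∞) ^ q * jweight a x ≤
        (c * wbW a A) ^ q * ∫⁻ x, (‖f x‖₊ : ℝ≥0∞) ^ q * jweight a x := by
      calc ∫⁻ x, (‖g x‖₊ : ℝ≥0∞) ^ q * jweight a x
          ≤ ∫⁻ x, (I ^ (q - 1) * c) * ∫⁻ y, (‖A (x - y)‖ₑ * jweight a (x - y)) *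
              (‖f y‖ₑ ^ q * jweight a y) := by
            apply lintegral_mono
            intro x
            calc (‖g x‖₊ : ℝ≥0∞) ^ q * jweight a x
                ≤ (I ^ (q - 1) * ∫⁻ y, ‖A (x - y)‖ₑ * ‖f y‖ₑ ^ q) * jweight a x := by
                  gcongr
                  exact step1 x
              _ = I ^ (q - 1) * ∫⁻ y, ‖A (x - y)‖ₑ * ‖f y‖ₑ ^ q * jweight a x := by
                  rw [lintegral_mul_const _ (by fun_prop), mul_assoc]
              _ ≤ I ^ (q - 1) * ∫⁻ y, c * ((‖A (x - y)‖ₑ * jweight a (x - y)) *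
                    (‖f y‖ₑ ^ q * jweight a y)) := by
                  refine mul_le_mul_right (lintegral_mono fun y => ?_) _
                  calc _ ≤ ‖A (x - y)‖ₑ * ‖f y‖ₑ ^ q *
                        (c * (jweight a (x - y) * jweight a y)) := by
                        gcongr
                        exact wb_peetre ha x y
                    _ = _ := by ring
              _ = _ := by
                  rw [lintegral_const_mul' _ _ ENNReal.ofReal_ne_top]
                  exact (mul_assoc _ _ _).symm
        _ = (I ^ (q - 1) * c) * ∫⁻ x, ∫⁻ y, (‖A (x - y)‖ₑ * jweight a (x - y)) *
              (‖f y‖ₑ ^ q * jweight a y) := by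
            rw [lintegral_const_mul]
            have := wb_jweight_meas (n := n) a
            apply Measurable.lintegral_prod_right' (f := fun z : Eu n × Eu n =>
              (‖A (z.1 - z.2)‖ₑ * jweight a (z.1 - z.2)) * (‖f z.2‖ₑ ^ q * jweight a z.2))
            fun_prop
        _ = (I ^ (q - 1) * c) * ∫⁻ y, ∫⁻ x, (‖A (x - y)‖ₑ * jweight a (x - y)) *
              (‖f y‖ₑ ^ q * jweight a y) := by
            rw [lintegral_lintegral_swap]
            have := wb_jweight_meas (n := n) a
            apply Measurable.aemeasurable
            unfold Function.uncurry
            fun_prop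
        _ = (I ^ (q - 1) * c) * ∫⁻ y, wbW a A * (‖f y‖ₑ ^ q * jweight a y) := by
            congr 2
            ext y
            have := wb_jweight_meas (n := n) a
            rw [lintegral_mul_const _ (by fun_prop), wbW,
              lintegral_sub_right_eq_self (fun x => ‖A x‖ₑ * jweight a x) y]
        _ = (I ^ (q - 1) * c) * wbW a A * ∫⁻ y, (‖f y‖ₑ ^ q * jweight a y) := by
            have := wb_jweight_meas (n := n) a
            rw [lintegral_const_mul _ (by fun_prop)]
            ring
        _ ≤ _ := by
            gcongr ?_ * ?_
            · calc I ^ (q - 1) * c * wbW a A ≤ (c * wbW a A) ^ (q - 1) * (c * wbW a A) ^ (1 : ℝ) := by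
                    rw [mul_assoc, ENNReal.rpow_one]
                    gcongr
                    · exact (wb_int_le_W ha A).trans (le_mul_of_one_le_left' hc1)
                _ = _ := by
                    rw [← ENNReal.rpow_add_of_nonneg _ _ (by linarith) (by norm_num)]
                    simp
            · exact le_rfl
    calc _ ≤ ((c * wbW a A) ^ q * ∫⁻ x, (‖f x‖₊ : ℝ≥0∞) ^ q * jweight a x) ^ (1 / q) := by
          gcongr
      _ = _ := by
          rw [ENNReal.mul_rpow_of_nonneg _ _ (by positivity), ← ENNReal.rpow_mul,
            mul_one_div_cancel hq0.ne', ENNReal.rpow_one]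

/-- bounded sets of Schwartz functions -/
def wbBdd {n : ℕ} (B : Set 𝓢(Eu n, ℂ)) : Prop :=
  ∀ i : ℕ × ℕ, ∃ C : ℝ, ∀ g ∈ B, schwartzSeminormFamily ℂ (Eu n) ℂ i g ≤ C

lemma wb_bdd_sup {n : ℕ} {B : Set 𝓢(Eu n, ℂ)} (hB : wbBdd B) (S : Finset (ℕ × ℕ)) :
    ∃ C : ℝ, 0 ≤ C ∧ ∀ g ∈ B, (S.sup (schwartzSeminormFamily ℂ (Eu n) ℂ)) g ≤ C := by
  choose C hC using hB
  have hnn : 0 ≤ ∑ i ∈ S, |C i| := Finset.sum_nonneg fun i _ => abs_nonneg _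
  refine ⟨∑ i ∈ S, |C i|, hnn, fun g hg => ?_⟩
  apply Seminorm.finset_sup_apply_le hnn
  intro i hi
  exact ((hC i g hg).trans (le_abs_self _)).trans
    (Finset.single_le_sum (f := fun i => |C i|) (fun i _ => abs_nonneg _) hi)

lemma wb_bdd_fourierInv {n : ℕ} {B : Set 𝓢(Eu n, ℂ)} (hB : wbBdd B) :
    wbBdd ((fun g : 𝓢(Eu n, ℂ) => (𝓕⁻ g : 𝓢(Eu n, ℂ))) '' B) := by
  intro i
  let T : 𝓢(Eu n, ℂ) →L[ℂ] 𝓢(Eu n, ℂ) := FourierTransform.fourierInvCLM ℂ 𝓢(Eu n, ℂ)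
  have hc : Continuous ((schwartzSeminormFamily ℂ (Eu n) ℂ i).comp T.toLinearMap) :=
    ((schwartz_withSeminorms ℂ (Eu n) ℂ).continuous_seminorm i).comp T.continuous
  obtain ⟨S, C, -, h⟩ := Seminorm.bound_of_continuous (schwartz_withSeminorms ℂ (Eu n) ℂ) _ hc
  obtain ⟨D, hD0, hD⟩ := wb_bdd_sup hB S
  refine ⟨C * D, ?_⟩
  rintro _ ⟨g, hg, rfl⟩
  refine (h g).trans ?_
  change (C : ℝ) * _ ≤ _
  gcongr
  exact hD g hg

lemma wb_bdd_W {n : ℕ} {B : Set 𝓢(Eu n, ℂ)} (hB : wbBdd B) {a : ℝ} (ha : 0 ≤ a) :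
    ∃ C : ℝ, 0 < C ∧ ∀ g ∈ B, wbW a g ≤ ENNReal.ofReal C := by
  obtain ⟨N, hN⟩ := exists_nat_ge (a + n + 1)
  obtain ⟨D, hD0, hD⟩ := wb_bdd_sup hB (Finset.Iic (N, 0))
  have hfin := finite_integral_one_add_norm (E := Eu n) (μ := volume) (r := n + 1) (by simp)
  set J := ∫⁻ x : Eu n, ENNReal.ofReal ((1 + ‖x‖) ^ (-((n : ℝ) + 1))) with hJ
  have key : ∀ g ∈ B, wbW a g ≤ ENNReal.ofReal (2 ^ N * D) * J := by
    intro g hg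
    rw [hJ, ← lintegral_const_mul' _ _ ENNReal.ofReal_ne_top, wbW]
    apply lintegral_mono
    intro y
    have h1 := SchwartzMap.one_add_le_sup_seminorm_apply (𝕜 := ℂ) (m := (N, 0)) (k := N) (n := 0)
      le_rfl le_rfl g y
    rw [norm_iteratedFDeriv_zero] at h1
    have h2 : (1 + ‖y‖) ^ N * ‖g y‖ ≤ 2 ^ N * D := by
      refine h1.trans ?_
      change 2 ^ N * _ ≤ _
      gcongr
      exact hD g hg
    have hy : 0 < 1 + ‖y‖ := by positivity
    have h3 : ((1 + ‖y‖ ^ 2) ^ (a / 2) : ℝ) ≤ (1 + ‖y‖) ^ a := by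
      calc ((1 + ‖y‖ ^ 2) ^ (a / 2) : ℝ) ≤ ((1 + ‖y‖) ^ (2 : ℝ)) ^ (a / 2) := by
            gcongr
            rw [Real.rpow_two]
            nlinarith [norm_nonneg y]
        _ = _ := by
            rw [← Real.rpow_mul hy.le]
            congr 1
            ring
    have h4 : ‖g y‖ * (1 + ‖y‖ ^ 2) ^ (a / 2) ≤ 2 ^ N * D * (1 + ‖y‖) ^ (-((n : ℝ) + 1)) := by
      calc ‖g y‖ * (1 + ‖y‖ ^ 2) ^ (a / 2) ≤ ‖g y‖ * (1 + ‖y‖) ^ a := by gcongr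
        _ ≤ ‖g y‖ * ((1 + ‖y‖) ^ ((N : ℝ) + (-((n : ℝ) + 1)))) := by
            gcongr
            · linarith [norm_nonneg y]
            · linarith
        _ = (1 + ‖y‖) ^ N * ‖g y‖ * (1 + ‖y‖) ^ (-((n : ℝ) + 1)) := by
            rw [Real.rpow_add hy, Real.rpow_natCast]
            ring
        _ ≤ _ := by gcongr
    calc ‖g y‖ₑ * jweight a y = ENNReal.ofReal (‖g y‖ * (1 + ‖y‖ ^ 2) ^ (a / 2)) := by
          rw [ENNReal.ofReal_mul (norm_nonneg _), ofReal_norm, jweight]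
      _ ≤ ENNReal.ofReal (2 ^ N * D * (1 + ‖y‖) ^ (-((n : ℝ) + 1))) :=
          ENNReal.ofReal_le_ofReal h4
      _ = _ := ENNReal.ofReal_mul (by positivity)
  refine ⟨2 ^ N * D * J.toReal + 1, by positivity, fun g hg => (key g hg).trans ?_⟩
  rw [← ENNReal.ofReal_toReal hfin.ne, ← ENNReal.ofReal_mul (by positivity)]
  apply ENNReal.ofReal_le_ofReal
  rw [ENNReal.toReal_ofReal ENNReal.toReal_nonneg]
  linarith

lemma wb_bdd_family {n : ℕ} (G : ℝ × Eu n → ℂ) (hG : ContDiff ℝ (⊤ : ℕ∞) G) (R : ℝ)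
    (hR : ∀ t η, R < ‖η‖ → G (t, η) = 0) :
    wbBdd {g : 𝓢(Eu n, ℂ) | ∃ t ∈ Set.Icc (0 : ℝ) 1, ∀ η, g η = G (t, η)} := by
  rintro ⟨k, l⟩
  have hK : IsCompact (Set.Icc (0 : ℝ) 1 ×ˢ Metric.closedBall (0 : Eu n) R) :=
    isCompact_Icc.prod (isCompact_closedBall _ _)
  have hcont : Continuous (fun z : ℝ × Eu n => ‖z.2‖ ^ k * ‖iteratedFDeriv ℝ l G z‖) := by
    have := hG.continuous_iteratedFDeriv (m := l) (by exact_mod_cast le_top)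
    fun_prop
  obtain ⟨C, hC⟩ := hK.exists_bound_of_continuousOn hcont.continuousOn
  refine ⟨|C|, ?_⟩
  rintro g ⟨t, ht, hg⟩
  have hg' : (⇑g : Eu n → ℂ) = (fun z => G ((t, 0) + z)) ∘ (ContinuousLinearMap.inr ℝ ℝ (Eu n)) := by
    ext η
    simp [hg]
  change SchwartzMap.seminorm ℂ k l g ≤ |C|
  apply SchwartzMap.seminorm_le_bound _ _ _ _ (abs_nonneg C)
  intro η
  by_cases hη : ‖η‖ ≤ R
  · have h1 : ‖iteratedFDeriv ℝ l g η‖ ≤ ‖iteratedFDeriv ℝ l G (t, η)‖ := by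
      rw [hg', ContinuousLinearMap.iteratedFDeriv_comp_right (i := l) (n := (⊤ : ℕ∞)) _
        (by fun_prop) _ (by exact_mod_cast le_top), iteratedFDeriv_comp_add_left]
      refine (ContinuousMultilinearMap.norm_compContinuousLinearMap_le _ _).trans ?_
      simp only [ContinuousLinearMap.inr_apply, Prod.mk_add_mk, add_zero, zero_add]
      apply mul_le_of_le_one_right (norm_nonneg _)
      apply Finset.prod_le_one (fun _ _ => norm_nonneg _)
      intro i _
      exact ContinuousLinearMap.norm_inr_le_one ..
    have h2 := hC (t, η) ⟨ht, by simpa using hη⟩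
    calc _ ≤ ‖η‖ ^ k * ‖iteratedFDeriv ℝ l G (t, η)‖ := by gcongr
      _ ≤ C := (le_abs_self _).trans h2
      _ ≤ |C| := le_abs_self C
  · have : iteratedFDeriv ℝ l g η = 0 := by
      by_contra hne
      have h3 := support_iteratedFDeriv_subset (𝕜 := ℝ) (f := g) l (Function.mem_support.2 hne)
      have h4 : tsupport g ⊆ Metric.closedBall 0 R := by
        apply closure_minimal _ Metric.isClosed_closedBall
        intro x hx
        by_contra hx'
        apply hx
        rw [hg]
        exact hR _ _ (by simpa using hx')
      exact hη (by simpa using h4 h3)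
    rw [this]
    simp

lemma wb_lintegral_smul {n : ℕ} (h : Eu n → ℝ≥0∞) {c : ℝ} (hc : 0 < c) :
    ENNReal.ofReal (c ^ n) * ∫⁻ x, h (c • x) = ∫⁻ x, h x := by
  have e : MeasurableEmbedding (fun x : Eu n => c • x) :=
    (Homeomorph.smulOfNeZero c hc.ne').measurableEmbedding
  rw [← e.lintegral_map, Measure.map_addHaar_smul _ hc.ne', lintegral_smul_measure,
    finrank_euclideanSpace_fin, smul_eq_mul, ← mul_assoc, ← ENNReal.ofReal_mul (by positivity),
    abs_of_nonneg (by positivity), mul_inv_cancel₀ (by positivity)]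
  simp

lemma wb_scale {n : ℕ} {a : ℝ} (ha : 0 ≤ a) (M : Eu n → ℂ) {c : ℝ} (hc : 1 ≤ c) :
    wbW a (𝓕⁻ (fun η => M (c⁻¹ • η))) ≤ wbW a (𝓕⁻ M) := by
  have hc0 : 0 < c := by linarith
  have e : ∀ x, 𝓕⁻ (fun η => M (c⁻¹ • η)) x = (c ^ n : ℝ) • 𝓕⁻ M (c • x) := by
    intro x
    rw [Real.fourierInv_eq, Real.fourierInv_eq]
    have := Measure.integral_comp_smul (volume : Measure (Eu n))
      (fun η => 𝐞 (⟪η, c • x⟫ : ℝ) • M η) c⁻¹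
    rw [abs_of_nonneg (by positivity), finrank_euclideanSpace_fin, inv_pow, inv_inv] at this
    rw [← this]
    congr 1
    ext η
    rw [inner_smul_left, inner_smul_right]
    simp [hc0.ne']
  rw [wbW, wbW, ← wb_lintegral_smul (fun y => ‖𝓕⁻ M y‖ₑ * jweight a y) hc0, ← lintegral_const_mul' _ _ ENNReal.ofReal_ne_top]
  apply lintegral_mono
  intro x
  simp only [e, enorm_smul]
  rw [mul_assoc, Real.enorm_eq_ofReal (by positivity)]
  gcongr
  unfold jweight
  apply ENNReal.ofReal_le_ofReal
  gcongr
  rw [norm_smul, Real.norm_of_nonneg hc0.le]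
  exact le_mul_of_one_le_left (norm_nonneg _) hc

lemma wb_W_add {n : ℕ} (a : ℝ) (A B : Eu n → ℂ) (hA : Continuous A) :
    wbW a (fun x => A x + B x) ≤ wbW a A + wbW a B := by
  have h1 := hA.measurable
  have h2 := wb_jweight_meas (n := n) a
  unfold wbW
  rw [← lintegral_add_left (by fun_prop)]
  gcongr with y
  rw [← add_mul]
  gcongr
  exact enorm_add_le _ _

/-- the dyadic family -/
def wbG {n : ℕ} (s : ℝ) (Φ : Eu n → ℝ) (z : ℝ × Eu n) : ℂ :=
  (((Φ ((2 * π) • z.2) - Φ ((2 : ℝ) • ((2 * π) • z.2))) *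
    (z.1 ^ 2 + ‖(2 * π) • z.2‖ ^ 2) ^ (s / 2) : ℝ) : ℂ)

lemma wb_G_smooth {n : ℕ} (s : ℝ) (Φ : Eu n → ℝ) (hΦ : IsLPBump Φ) :
    ContDiff ℝ (⊤ : ℕ∞) (wbG s Φ) := by
  obtain ⟨h1, h2, h3, h4⟩ := hΦ
  rw [contDiff_iff_contDiffAt]
  rintro ⟨t, ζ⟩
  by_cases hz : ‖(2 * π) • ζ‖ < 1 / 2
  · have : (wbG s Φ) =ᶠ[nhds (t, ζ)] fun _ => 0 := by
      have hc : Continuous (fun z : ℝ × Eu n => ‖(2 * π) • z.2‖) := by fun_prop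
      filter_upwards [(isOpen_lt hc continuous_const).mem_nhds hz] with z hz'
      have hz' : ‖(2 * π) • z.2‖ < 1 / 2 := hz'
      rw [wbG, h3 _ (by linarith), h3 _ (by rw [norm_smul, Real.norm_two]; linarith)]
      simp
    exact contDiffAt_const.congr_of_eventuallyEq this
  · have hpos : 0 < t ^ 2 + ‖(2 * π) • ζ‖ ^ 2 := by
      have : 0 < ‖(2 * π) • ζ‖ := by linarith
      positivity
    unfold wbG
    apply Complex.ofRealCLM.contDiff.contDiffAt.comp
    apply ContDiffAt.mul
    · apply ContDiff.contDiffAt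
      fun_prop
    · refine ContDiffAt.rpow_const_of_ne (f := fun z : ℝ × Eu n => z.1 ^ 2 + ‖(2 * π) • z.2‖ ^ 2) ?_ hpos.ne'
      apply ContDiff.contDiffAt
      have : ContDiff ℝ (⊤ : ℕ∞) (fun z : ℝ × Eu n => ‖(2 * π) • z.2‖ ^ 2) :=
        ContDiff.norm_sq ℝ (by fun_prop)
      fun_prop

lemma wb_M_smooth {n : ℕ} (s : ℝ) (Φ : Eu n → ℝ) (hΦ : IsLPBump Φ) (k : ℕ) :
    ContDiff ℝ (⊤ : ℕ∞) (wbM s Φ k) := by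
  have h1 := hΦ.1
  unfold wbM
  apply ContDiff.mul
  · exact Complex.ofRealCLM.contDiff.comp (by fun_prop)
  · apply Complex.ofRealCLM.contDiff.comp
    apply ContDiff.rpow_const_of_ne
    · have : ContDiff ℝ (⊤ : ℕ∞) (fun z : Eu n => ‖(2 * π) • z‖ ^ 2) :=
        ContDiff.norm_sq ℝ (by fun_prop)
      fun_prop
    · intro x
      positivity

lemma wb_Phi_zero {n : ℕ} {Φ : Eu n → ℝ} (hΦ : IsLPBump Φ) {c : ℝ} (hc : 0 < c) (η : Eu n)
    (hη : 2 / c < ‖η‖) : Φ (c • ((2 * π) • η)) = 0 := by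
  apply hΦ.2.2.2
  rw [norm_smul, norm_smul, Real.norm_of_nonneg hc.le, Real.norm_of_nonneg (by positivity)]
  rw [div_lt_iff₀ hc] at hη
  nlinarith [Real.pi_gt_three, mul_nonneg (norm_nonneg η) hc.le]

lemma wb_M_zero {n : ℕ} (s : ℝ) (Φ : Eu n → ℝ) (hΦ : IsLPBump Φ) (k : ℕ) (η : Eu n)
    (hη : 2 / (2 : ℝ) ^ (-(k : ℤ)) < ‖η‖) : wbM s Φ k η = 0 := by
  rw [wbM, wb_Phi_zero hΦ (by positivity) η hη]
  simp

lemma wb_G_zero {n : ℕ} (s : ℝ) (Φ : Eu n → ℝ) (hΦ : IsLPBump Φ) (t : ℝ) (η : Eu n)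
    (hη : 2 < ‖η‖) : wbG s Φ (t, η) = 0 := by
  have h1 := wb_Phi_zero hΦ one_pos η (by simpa using hη)
  rw [one_smul] at h1
  simp only [wbG]
  rw [h1, wb_Phi_zero hΦ two_pos η (by linarith)]
  simp

lemma wb_toS {n : ℕ} (M : Eu n → ℂ) (hM : ContDiff ℝ (⊤ : ℕ∞) M) (R : ℝ)
    (hR : ∀ η, R < ‖η‖ → M η = 0) : ∃ g : 𝓢(Eu n, ℂ), ⇑g = M := by
  have : HasCompactSupport M := by
    apply HasCompactSupport.intro (isCompact_closedBall 0 R)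
    intro x hx
    exact hR x (by simpa using hx)
  exact ⟨this.toSchwartzMap hM, rfl⟩

lemma wb_M_S {n : ℕ} (s : ℝ) (Φ : Eu n → ℝ) (hΦ : IsLPBump Φ) (k : ℕ) :
    ∃ g : 𝓢(Eu n, ℂ), ⇑g = wbM s Φ k :=
  wb_toS _ (wb_M_smooth s Φ hΦ k) _ (wb_M_zero s Φ hΦ k)

lemma wb_G_S {n : ℕ} (s : ℝ) (Φ : Eu n → ℝ) (hΦ : IsLPBump Φ) (t : ℝ) :
    ∃ g : 𝓢(Eu n, ℂ), ⇑g = fun η => wbG s Φ (t, η) :=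
  wb_toS _ ((wb_G_smooth s Φ hΦ).comp (by fun_prop)) 2 (wb_G_zero s Φ hΦ t)

/-- Uniform kernel bound for a smooth compactly supported family. -/
lemma wb_family_W {n : ℕ} {a : ℝ} (ha : 0 ≤ a) (G : ℝ × Eu n → ℂ)
    (hG : ContDiff ℝ (⊤ : ℕ∞) G) (R : ℝ)
    (hR : ∀ t η, R < ‖η‖ → G (t, η) = 0) :
    ∃ C : ℝ, 0 < C ∧ ∀ t ∈ Set.Icc (0 : ℝ) 1,
      wbW a (𝓕⁻ (fun η => G (t, η))) ≤ ENNReal.ofReal C := by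
  obtain ⟨C, hC, h⟩ := wb_bdd_W (wb_bdd_fourierInv (wb_bdd_family G hG R hR)) ha
  refine ⟨C, hC, fun t ht => ?_⟩
  obtain ⟨g, hg⟩ := wb_toS (fun η => G (t, η)) (hG.comp (by fun_prop)) R (hR t)
  have := h _ ⟨g, ⟨t, ht, fun η => by rw [hg]⟩, rfl⟩
  rw [← hg, ← SchwartzMap.fourierInv_coe]
  exact this

lemma wb_M_succ {n : ℕ} (s : ℝ) (Φ : Eu n → ℝ) (k : ℕ) (η : Eu n) :
    wbM s Φ (k + 1) η = wbM s Φ k η +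
      (((2 : ℝ) ^ (((k + 1 : ℕ) : ℝ) * s) : ℝ) : ℂ) *
        wbG s Φ (((2 : ℝ) ^ (k + 1))⁻¹, ((2 : ℝ) ^ (k + 1))⁻¹ • η) := by
  set c : ℝ := (2 : ℝ) ^ (k + 1) with hc
  have hc0 : 0 < c := by positivity
  have e1 : (2 : ℝ) ^ (-((k + 1 : ℕ) : ℤ)) = c⁻¹ := by
    rw [zpow_neg, zpow_natCast]
  have e2 : (2 : ℝ) ^ (-(k : ℤ)) = 2 * c⁻¹ := by
    rw [zpow_neg, zpow_natCast, hc, pow_succ]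
    field_simp
  have e3 : (2 : ℝ) ^ (((k + 1 : ℕ) : ℝ) * s) = (c ^ 2) ^ (s / 2) := by
    rw [Real.rpow_mul (by norm_num), Real.rpow_natCast, ← Real.rpow_natCast c 2,
      ← Real.rpow_mul hc0.le]
    congr 1
    push_cast
    ring
  have e4 : (1 + ‖(2 * π) • η‖ ^ 2 : ℝ) =
      c ^ 2 * (c⁻¹ ^ 2 + ‖c⁻¹ • ((2 * π) • η)‖ ^ 2) := by
    rw [norm_smul c⁻¹, Real.norm_of_nonneg (by positivity)]
    field_simp
  have e5 : (2 * π) • (c⁻¹ • η) = c⁻¹ • ((2 * π) • η) := smul_comm _ _ _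
  simp only [wbM, wbG]
  rw [e1, e2, e3, e4, e5, mul_smul 2 c⁻¹, Real.mul_rpow (by positivity) (by positivity)]
  push_cast
  ring

lemma wb_kernel_succ {n : ℕ} {s a : ℝ} (ha : 0 ≤ a) (Φ : Eu n → ℝ) (hΦ : IsLPBump Φ) (k : ℕ) :
    wbW a (𝓕⁻ (wbM s Φ (k + 1))) ≤ wbW a (𝓕⁻ (wbM s Φ k)) +
      ENNReal.ofReal ((2 : ℝ) ^ (((k + 1 : ℕ) : ℝ) * s)) *
        wbW a (𝓕⁻ (fun η => wbG s Φ (((2 : ℝ) ^ (k + 1))⁻¹, η))) := by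
  set c : ℝ := (2 : ℝ) ^ (k + 1) with hc
  have hc1 : 1 ≤ c := one_le_pow₀ (by norm_num)
  have hc0 : 0 < c := by linarith
  set b : ℝ := (2 : ℝ) ^ (((k + 1 : ℕ) : ℝ) * s) with hb
  have hb0 : 0 < b := by positivity
  obtain ⟨g, hg⟩ := wb_M_S s Φ hΦ k
  obtain ⟨h, hh⟩ := wb_G_S s Φ hΦ c⁻¹
  have hi : Integrable (fun η => h (c⁻¹ • η)) := by
    exact (integrable_comp_smul_iff volume (⇑h) (by positivity)).2 h.integrable
  have e : ∀ x, 𝓕⁻ (wbM s Φ (k + 1)) x =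
      𝓕⁻ (wbM s Φ k) x + (b : ℂ) * 𝓕⁻ (fun η => h (c⁻¹ • η)) x := by
    intro x
    have e0 : wbM s Φ (k + 1) = fun η => g η + (b : ℂ) * h (c⁻¹ • η) := by
      ext η
      rw [wb_M_succ, hg, hh]
    have conv : ∀ F : Eu n → ℂ, Integrable F →
        Integrable (fun η : Eu n => 𝐞 (⟪η, x⟫ : ℝ) • F η) := by
      intro F hF
      simpa using (Real.fourierIntegral_convergent_iff (V := Eu n) (f := F) (-x)).2 hF
    rw [e0, ← hg, Real.fourierInv_eq, Real.fourierInv_eq, Real.fourierInv_eq]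
    rw [← integral_const_mul, ← integral_add (conv _ g.integrable) ((conv _ hi).const_mul _)]
    congr 1
    ext v
    simp only [Circle.smul_def, smul_eq_mul]
    ring
  have e' : 𝓕⁻ (wbM s Φ (k + 1)) = fun x =>
      𝓕⁻ (wbM s Φ k) x + (b : ℂ) * 𝓕⁻ (fun η => h (c⁻¹ • η)) x := funext e
  rw [e']
  refine (wb_W_add a _ _ ?_).trans ?_
  · rw [← hg, ← SchwartzMap.fourierInv_coe]
    exact (𝓕⁻ g : 𝓢(Eu n, ℂ)).continuous
  gcongr
  calc wbW a (fun x => (b : ℂ) * 𝓕⁻ (fun η => h (c⁻¹ • η)) x)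
      = ENNReal.ofReal b * wbW a (𝓕⁻ (fun η => h (c⁻¹ • η))) := by
        unfold wbW
        rw [← lintegral_const_mul' _ _ ENNReal.ofReal_ne_top]
        congr 1
        ext y
        rw [enorm_mul, mul_assoc]
        congr 1
        rw [← ofReal_norm, Complex.norm_real, Real.norm_of_nonneg hb0.le]
    _ ≤ ENNReal.ofReal b * wbW a (𝓕⁻ (⇑h)) := by
        gcongr
        exact wb_scale ha _ hc1
    _ = _ := by rw [hh]

lemma wb_kernel {n : ℕ} {s a : ℝ} (hs : 0 < s) (ha : 0 ≤ a) (Φ : Eu n → ℝ) (hΦ : IsLPBump Φ) :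
    ∃ C : ℝ, 0 < C ∧ ∀ k : ℕ,
      wbW a (𝓕⁻ (wbM s Φ k)) ≤ ENNReal.ofReal (C * 2 ^ ((k : ℝ) * s)) := by
  obtain ⟨C0, hC0, h0⟩ := wb_family_W ha (fun z => wbM s Φ 0 z.2)
    ((wb_M_smooth s Φ hΦ 0).comp (by fun_prop)) _ (fun _ => wb_M_zero s Φ hΦ 0)
  obtain ⟨C1, hC1, h1⟩ := wb_family_W ha (wbG s Φ) (wb_G_smooth s Φ hΦ) 2 (wb_G_zero s Φ hΦ)
  have hd : 0 < 1 - (2 : ℝ) ^ (-s) := by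
    have : (2 : ℝ) ^ (-s) < 1 := Real.rpow_lt_one_of_one_lt_of_neg (by norm_num) (by linarith)
    linarith
  set d := 1 - (2 : ℝ) ^ (-s) with hddef
  refine ⟨C0 + C1 / d, by positivity, fun k => ?_⟩
  induction k with
  | zero =>
    refine (h0 0 (by simp)).trans (ENNReal.ofReal_le_ofReal ?_)
    have : 0 < C1 / d := by positivity
    simp
    linarith
  | succ k ih =>
    refine (wb_kernel_succ ha Φ hΦ k).trans ?_
    have h2 := h1 (((2 : ℝ) ^ (k + 1))⁻¹) ⟨by positivity, inv_le_one_of_one_le₀ (one_le_pow₀ (by norm_num))⟩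
    refine (add_le_add ih (mul_le_mul_right h2 _)).trans ?_
    rw [← ENNReal.ofReal_mul (by positivity), ← ENNReal.ofReal_add (by positivity) (by positivity)]
    apply ENNReal.ofReal_le_ofReal
    have e : (2 : ℝ) ^ ((k : ℝ) * s) = 2 ^ (((k + 1 : ℕ) : ℝ) * s) * 2 ^ (-s) := by
      rw [← Real.rpow_add (by norm_num)]
      congr 1
      push_cast
      ring
    rw [e]
    have e2 : (2 : ℝ) ^ (-s) = 1 - d := by rw [hddef]; ring
    rw [e2]
    have hb : 0 < (2 : ℝ) ^ (((k + 1 : ℕ) : ℝ) * s) := by positivity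
    set b := (2 : ℝ) ^ (((k + 1 : ℕ) : ℝ) * s)
    have e3 : C1 / d * d = C1 := by field_simp
    have : 0 < b * (C0 * d) := by positivity
    calc _ = (C0 + C1 / d) * b - b * (C0 * d) - b * (C1 / d * d) + b * C1 := by ring
      _ ≤ _ := by rw [e3]; linarith

/-- **Weighted Bernstein inequality for `J^s` composed with `S_k`** (Lemma 3.3 (iii)). -/
theorem weighted_bernstein_low (n : ℕ) (hn : 1 ≤ n) (s : ℝ) (hs : 0 < s)
    (p : ℝ≥0∞) (hp : 1 ≤ p) (a : ℝ) (ha : 0 ≤ a)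
    (Φ : Eu n → ℝ) (hΦ : IsLPBump Φ) :
    ∃ C : ℝ, 0 < C ∧ ∀ k : ℕ, ∀ f : SchwartzMap (Eu n) ℂ,
      wNorm p a (SProj Φ (k : ℤ) (Js s ⇑f)) ≤
        ENNReal.ofReal (C * 2 ^ ((k : ℝ) * s)) * wNorm p a ⇑f := by
  obtain ⟨C, hC, hk⟩ := wb_kernel hs ha Φ hΦ
  refine ⟨2 ^ (a / 2) * C, by positivity, fun k f => ?_⟩
  obtain ⟨g, hg⟩ := wb_M_S s Φ hΦ k
  have hA : Continuous (𝓕⁻ (wbM s Φ k)) := by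
    rw [← hg, ← SchwartzMap.fourierInv_coe]
    exact (𝓕⁻ g : 𝓢(Eu n, ℂ)).continuous
  refine (wb_young p hp ha (𝓕⁻ (wbM s Φ k)) f _ hA f.continuous ?_).trans ?_
  · intro x
    rw [wb_comp, wb_conv _ _ (by rw [← hg]; exact g.integrable) f.integrable]
    refine (enorm_integral_le_lintegral_enorm _).trans ?_
    simp only [enorm_mul]
    exact le_rfl
  · gcongr
    rw [mul_assoc, ENNReal.ofReal_mul (by positivity)]
    gcongr
    exact hk k
end
end

section
/- (Weighted Bernstein inequality, interpolated gradient bound) Let n ≥ 1, s > 0, p ∈ [1,∞], a ≥ 0, and 0 ≤ ε < min(1, s). Then there exists C > 0, depending only on n, a, p, s, ε and Φ, such that for every k ∈ ℕ and every f ∈ 𝒮(ℝⁿ): ‖∇(S_k f)‖_{L^p_{⟨x⟩^a}} ≤ C 2^{k(1−ε)} ‖f‖_{L^p_{⟨x⟩^a}}^{1−ε/s} ‖J^s f‖_{L^p_{⟨x⟩^a}}^{ε/s}. -/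
open MeasureTheory Real Complex
open scoped ENNReal NNReal RealInnerProductSpace

noncomputable section

/-- The Euclidean norm `|∇f|(x)` of the gradient of a complex-valued function. -/
def gradNorm {n : ℕ} (f : Eu n → ℂ) (x : Eu n) : ℝ :=
  Real.sqrt (∑ j : Fin n, ‖fderiv ℝ f x (EuclideanSpace.single j 1)‖ ^ 2)

/-- The "dot product" of gradients `∇f·∇g = Σ_j (∂_j f)(∂_j g)`. -/
def gradDot {n : ℕ} (f g : Eu n → ℂ) (x : Eu n) : ℂ :=
  ∑ j : Fin n, fderiv ℝ f x (EuclideanSpace.single j 1) *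
    fderiv ℝ g x (EuclideanSpace.single j 1)

open FourierTransform SchwartzMap in
lemma seminorm_family_bound {n : ℕ} (M : ℝ × Eu n → ℂ) (hM : ContDiff ℝ (⊤ : ℕ∞) M) (R : ℝ)
    (hR : ∀ t η, R ≤ ‖η‖ → M (t, η) = 0) (k l : ℕ) :
    ∃ B : ℝ, 0 ≤ B ∧ ∀ t ∈ Set.Icc (0:ℝ) 1, ∀ m : 𝓢(Eu n, ℂ), (∀ η, m η = M (t, η)) →
      SchwartzMap.seminorm ℂ k l m ≤ B := by
  have hcomp : IsCompact (Set.Icc (0:ℝ) 1 ×ˢ Metric.closedBall (0 : Eu n) R) :=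
    isCompact_Icc.prod (isCompact_closedBall 0 R)
  have hcont : Continuous (fun z : ℝ × Eu n => ‖z.2‖ ^ k * ‖iteratedFDeriv ℝ l M z‖) := by
    apply Continuous.mul (by fun_prop)
    exact (hM.continuous_iteratedFDeriv (by exact_mod_cast le_top)).norm
  obtain ⟨B, hB⟩ := hcomp.exists_bound_of_continuousOn hcont.continuousOn
  refine ⟨max B 0, le_max_right _ _, fun t ht m hm => ?_⟩
  refine SchwartzMap.seminorm_le_bound ℂ k l m (le_max_right _ _) (fun η => ?_)
  by_cases hη : ‖η‖ ≤ R
  · refine le_trans ?_ (le_max_left _ _)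
    refine le_trans ?_ ((le_abs_self _).trans (hB (t, η) ⟨ht, by simpa using hη⟩))
    simp only
    gcongr
    have h1 : (m : Eu n → ℂ) = (fun z => M ((t, 0) + z)) ∘ (ContinuousLinearMap.inr ℝ ℝ (Eu n)) := by
      ext x; simp [hm]
    have hM2 : ContDiff ℝ (⊤ : ℕ∞) (fun z => M ((t, 0) + z)) :=
      hM.comp (contDiff_const.add contDiff_id)
    rw [h1, ContinuousLinearMap.iteratedFDeriv_comp_right _ hM2 _ (by exact_mod_cast le_top)]
    refine (ContinuousMultilinearMap.norm_compContinuousLinearMap_le _ _).trans ?_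
    rw [iteratedFDeriv_comp_add_left]
    simp only [ContinuousLinearMap.inr_apply, Prod.mk_add_mk, add_zero, zero_add, Finset.prod_const]
    refine mul_le_of_le_one_right (norm_nonneg _) (pow_le_one₀ (norm_nonneg _) ?_)
    exact ContinuousLinearMap.norm_inr_le_one ℝ ℝ (Eu n)
  · have : iteratedFDeriv ℝ l m η = 0 := by
      by_contra h
      have h2 := support_iteratedFDeriv_subset (𝕜 := ℝ) l (f := m) h
      have h3 : tsupport m ⊆ Metric.closedBall 0 R := by
        refine closure_minimal (fun x hx => ?_) Metric.isClosed_closedBall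
        by_contra hx2
        exact hx (by rw [hm]; exact hR _ _ (by simp at hx2; exact hx2.le))
      exact hη (by simpa using h3 h2)
    rw [this]; simp

lemma contDiff_jap {n : ℕ} (r : ℝ) : (fun x : Eu n => (1 + ‖x‖ ^ 2) ^ r).HasTemperateGrowth :=
  Function.hasTemperateGrowth_one_add_norm_sq_rpow (Eu n) r

open FourierTransform SchwartzMap in
lemma kernel_bound {n : ℕ} (M : ℝ × Eu n → ℂ) (hM : ContDiff ℝ (⊤ : ℕ∞) M) (R : ℝ)
    (hR : ∀ t η, R ≤ ‖η‖ → M (t, η) = 0) (a : ℝ) :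
    ∃ B : ℝ, 0 ≤ B ∧ ∀ t ∈ Set.Icc (0:ℝ) 1, ∀ m : 𝓢(Eu n, ℂ), (∀ η, m η = M (t, η)) →
      ∫⁻ u, ‖(𝓕⁻ m : 𝓢(Eu n, ℂ)) u‖ₑ * jweight a u ≤ ENNReal.ofReal B := by
  have : Fact ((1:ℝ≥0∞) ≤ 1) := ⟨le_rfl⟩
  set J : Eu n → ℂ := fun x => (((1 + ‖x‖ ^ 2) ^ (a/2) : ℝ) : ℂ) with hJ
  have hJt : J.HasTemperateGrowth :=
    Function.Complex.hasTemperateGrowth_ofReal.comp (contDiff_jap (a/2))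
  set T : 𝓢(Eu n, ℂ) →L[ℂ] Lp ℂ 1 (volume : Measure (Eu n)) :=
    (SchwartzMap.toLpCLM ℂ ℂ 1 volume) ∘L (smulLeftCLM ℂ J) ∘L (fourierInvCLM ℂ 𝓢(Eu n, ℂ)) with hT
  have hTc : Continuous ((normSeminorm ℂ (Lp ℂ 1 (volume : Measure (Eu n)))).comp T.toLinearMap) := by
    exact continuous_norm.comp T.continuous
  obtain ⟨s, C, hC, hs⟩ := Seminorm.bound_of_continuous (schwartz_withSeminorms ℂ (Eu n) ℂ) _ hTc
  choose B hB0 hB using seminorm_family_bound M hM R hR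
  refine ⟨C * ∑ i ∈ s, B i.1 i.2, ?_, fun t ht m hm => ?_⟩
  · exact mul_nonneg C.2 (Finset.sum_nonneg fun i _ => hB0 _ _)
  have h1 : ‖T m‖ ≤ C * ∑ i ∈ s, B i.1 i.2 := by
    refine (hs m).trans ?_
    change (C:ℝ) * (s.sup (schwartzSeminormFamily ℂ (Eu n) ℂ)) m ≤ _
    gcongr
    refine Seminorm.finset_sup_apply_le (Finset.sum_nonneg fun i _ => hB0 _ _) (fun i hi => ?_)
    refine (hB i.1 i.2 t ht m hm).trans ?_
    exact Finset.single_le_sum (f := fun i : ℕ × ℕ => B i.1 i.2) (fun i _ => hB0 _ _) hi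
  refine le_trans (le_of_eq ?_) (ENNReal.ofReal_le_ofReal h1)
  have h2 : T m = (smulLeftCLM ℂ J (𝓕⁻ m : 𝓢(Eu n, ℂ))).toLp 1 volume := rfl
  rw [h2, SchwartzMap.norm_toLp, ENNReal.ofReal_toReal (SchwartzMap.eLpNorm_lt_top _ _ _).ne,
    eLpNorm_one_eq_lintegral_enorm]
  refine lintegral_congr fun u => ?_
  rw [smulLeftCLM_apply_apply hJt, smul_eq_mul, enorm_mul, mul_comm]
  congr 1
  rw [hJ, jweight, ← ofReal_norm, Complex.norm_real, Real.norm_of_nonneg]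
  positivity

open FourierTransform SchwartzMap in
lemma mult_eq_conv {n : ℕ} (m g : 𝓢(Eu n, ℂ)) (μ : Eu n → ℂ) (hμ : μ.HasTemperateGrowth)
    (t : ℝ) (ht : 0 < t) (hm : ∀ ξ, μ ξ = m (t • ξ)) (x : Eu n) :
    fourierMultiplierCLM ℂ μ g x = ∫ u, (𝓕⁻ m : 𝓢(Eu n, ℂ)) u * g (x - t • u) := by
  -- the map `z ↦ g (x - t z)` as a Schwartz function
  set e : Eu n ≃L[ℝ] Eu n := ContinuousLinearEquiv.smulLeft (Units.mk0 (-t) (neg_ne_zero.2 ht.ne'))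
  set G : 𝓢(Eu n, ℂ) :=
    compCLMOfContinuousLinearEquiv ℂ e (compSubConstCLM ℂ (-x) g) with hG
  have hGu : ∀ u, G u = g (x - t • u) := by
    intro u
    simp only [hG, compCLMOfContinuousLinearEquiv_apply, Function.comp, compSubConstCLM_apply]
    congr 1
    have : e u = (-t) • u := rfl
    rw [this]; module
  have h1 : ∫ u, (𝓕⁻ m : 𝓢(Eu n, ℂ)) u * g (x - t • u) = ∫ ξ, m ξ * (𝓕⁻ G : 𝓢(Eu n, ℂ)) ξ := by
    rw [← SchwartzMap.integral_fourierInv_mul_eq]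
    simp_rw [hGu]
  rw [h1, fourierMultiplierCLM_apply]
  have h2 : (𝓕⁻ ((smulLeftCLM ℂ μ) (𝓕 g)) : 𝓢(Eu n, ℂ)) x
      = ∫ ξ, 𝐞 (inner ℝ ξ x) • (m (t • ξ) * (𝓕 (g : Eu n → ℂ)) ξ) := by
    rw [fourierInv_coe, Real.fourierInv_eq]
    refine integral_congr_ae (ae_of_all _ fun ξ => ?_)
    simp only
    rw [smulLeftCLM_apply_apply hμ, hm, smul_eq_mul, fourier_coe]
  rw [h2]
  -- change variables
  have h3 : ∀ ξ, (𝓕⁻ G : 𝓢(Eu n, ℂ)) (t • ξ)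
      = (((t ^ n)⁻¹ : ℝ) : ℂ) * (𝐞 (inner ℝ ξ x) • (𝓕 (g : Eu n → ℂ)) ξ) := by
    intro ξ
    rw [fourierInv_coe, Real.fourierInv_eq, Real.fourier_eq]
    have h4 := Measure.integral_comp_smul (volume : Measure (Eu n))
      (fun y => 𝐞 (inner ℝ y ξ) • g (x - y)) t
    simp only [finrank_euclideanSpace, Fintype.card_fin] at h4
    rw [abs_of_pos (by positivity)] at h4
    have h5 : ∫ v, 𝐞 (inner ℝ v (t • ξ)) • G v = ∫ v, 𝐞 (inner ℝ (t • v) ξ) • g (x - t • v) := by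
      simp_rw [hGu, inner_smul_left, inner_smul_right]
      simp
    rw [h5, h4, Complex.real_smul]
    congr 1
    rw [← integral_sub_left_eq_self _ volume x, Circle.smul_def, smul_eq_mul,
      ← integral_const_mul]
    refine integral_congr_ae (ae_of_all _ fun y => ?_)
    simp only [sub_sub_cancel]
    rw [inner_sub_left, real_inner_comm ξ x, sub_eq_add_neg, AddChar.map_add_eq_mul]
    simp only [Circle.smul_def, smul_eq_mul, Circle.coe_mul]
    ring
  have h6 := Measure.integral_comp_smul (volume : Measure (Eu n))
      (fun ξ => m ξ * (𝓕⁻ G : 𝓢(Eu n, ℂ)) ξ) t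
  simp only [finrank_euclideanSpace, Fintype.card_fin] at h6
  rw [abs_of_pos (by positivity)] at h6
  have h7 : ∫ ξ, m ξ * (𝓕⁻ G : 𝓢(Eu n, ℂ)) ξ
      = ((t ^ n : ℝ) : ℂ) * ∫ ξ, m (t • ξ) * (𝓕⁻ G : 𝓢(Eu n, ℂ)) (t • ξ) := by
    rw [h6, Complex.real_smul, ← mul_assoc, ← Complex.ofReal_mul, mul_inv_cancel₀ (by positivity)]
    simp
  rw [h7, ← integral_const_mul]
  refine integral_congr_ae (ae_of_all _ fun ξ => ?_)
  simp only
  rw [h3, Circle.smul_def, Circle.smul_def, smul_eq_mul, smul_eq_mul]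
  have : ((t ^ n : ℝ) : ℂ) ≠ 0 := by exact_mod_cast (pow_pos ht n).ne'
  rw [Complex.ofReal_inv]
  field_simp

lemma peetre {n : ℕ} (a : ℝ) (ha : 0 ≤ a) (t : ℝ) (ht : t ∈ Set.Icc (0:ℝ) 1) (y u : Eu n) :
    jweight a (y + t • u) ≤ ENNReal.ofReal (2 ^ (a/2)) * jweight a u * jweight a y := by
  unfold jweight
  rw [← ENNReal.ofReal_mul (by positivity), ← ENNReal.ofReal_mul (by positivity),
    ← Real.mul_rpow (by positivity) (by positivity), ← Real.mul_rpow (by positivity) (by positivity)]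
  refine ENNReal.ofReal_le_ofReal (Real.rpow_le_rpow (by positivity) ?_ (by positivity))
  have h1 : ‖y + t • u‖ ≤ ‖y‖ + ‖u‖ := by
    refine (norm_add_le _ _).trans ?_
    gcongr
    rw [norm_smul, Real.norm_of_nonneg ht.1]
    exact mul_le_of_le_one_left (norm_nonneg _) ht.2
  have h2 : ‖y + t • u‖ ^ 2 ≤ (‖y‖ + ‖u‖) ^ 2 := by gcongr
  nlinarith [sq_nonneg (‖y‖ - ‖u‖), sq_nonneg (‖y‖ * ‖u‖)]

lemma measurable_jweight {n : ℕ} (a : ℝ) : Measurable (jweight a : Eu n → ℝ≥0∞) := by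
  unfold jweight
  fun_prop

lemma one_le_jweight {n : ℕ} (a : ℝ) (ha : 0 ≤ a) (x : Eu n) : 1 ≤ jweight a x := by
  unfold jweight
  rw [← ENNReal.ofReal_one]
  refine ENNReal.ofReal_le_ofReal (Real.one_le_rpow ?_ (by positivity))
  nlinarith [sq_nonneg ‖x‖]

lemma wNorm_eq {n : ℕ} {F : Type*} [NormedAddCommGroup F] (p : ℝ≥0∞) (hp : 1 ≤ p) (a : ℝ)
    (ha : 0 ≤ a) (f : Eu n → F) (hf : AEStronglyMeasurable f volume):
    wNorm p a f = eLpNorm f p (volume.withDensity (jweight a)) := by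
  have hp0 : p ≠ 0 := (zero_lt_one.trans_le hp).ne'
  unfold wNorm
  split_ifs with h
  · subst h
    rw [eLpNorm_exponent_top]
    refine le_antisymm ?_ ?_
    · exact essSup_mono_measure (withDensity_absolutelyContinuous' (measurable_jweight a).aemeasurable
        (ae_of_all _ fun x => (zero_lt_one.trans_le (one_le_jweight a ha x)).ne'))
    · exact essSup_mono_measure (withDensity_absolutelyContinuous _ _)
  · rw [eLpNorm_eq_lintegral_rpow_enorm_toReal hp0 h]
    congr 1
    rw [lintegral_withDensity_eq_lintegral_mul₀ (measurable_jweight a).aemeasurable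
      (hf.enorm.pow_const _)]
    refine lintegral_congr fun x => ?_
    simp [mul_comm, enorm]

lemma conv_bound {n : ℕ} (p : ℝ≥0∞) (hp : 1 ≤ p) (a : ℝ) (ha : 0 ≤ a) (K g h : Eu n → ℂ)
    (hK : Continuous K) (hg : Continuous g) (t : ℝ) (ht : t ∈ Set.Icc (0:ℝ) 1) (ht0 : 0 < t)
    (hh : ∀ x, h x = ∫ u, K u * g (x - t • u)) :
    wNorm p a h ≤ ENNReal.ofReal (2 ^ (a/2)) * (∫⁻ u, ‖K u‖ₑ * jweight a u) * wNorm p a g := by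
  set N := ∫⁻ u, ‖K u‖ₑ * jweight a u with hN
  have hc1 : 1 ≤ ENNReal.ofReal ((2:ℝ) ^ (a/2)) := by
    rw [← ENNReal.ofReal_one]
    exact ENNReal.ofReal_le_ofReal (Real.one_le_rpow (by norm_num) (by positivity))
  set c := ENNReal.ofReal ((2:ℝ) ^ (a/2)) with hc
  have hKN : ∫⁻ u, ‖K u‖ₑ ≤ N := by
    refine lintegral_mono fun u => ?_
    exact le_mul_of_one_le_right (by simp) (one_le_jweight a ha u)
  have hpt : ∀ x, ‖h x‖ₑ ≤ ∫⁻ u, ‖K u‖ₑ * ‖g (x - t • u)‖ₑ := by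
    intro x
    rw [hh]
    refine (enorm_integral_le_lintegral_enorm _).trans (le_of_eq ?_)
    simp_rw [enorm_mul]
  by_cases hpt' : p = ∞
  · unfold wNorm
    simp only [hpt', if_true]
    refine essSup_le_of_ae_le _ (ae_of_all _ fun x => ?_)
    refine (hpt x).trans ?_
    set S := essSup (fun x => (‖g x‖₊ : ℝ≥0∞)) volume
    have hS : ∀ᵐ u : Eu n, ‖g (x - t • u)‖ₑ ≤ S := by
      have h1 : ∀ y, ‖g y‖ₑ ≤ S := by
        intro y
        have h2 : ∀ᵐ y, ‖g y‖ₑ ≤ S := ENNReal.ae_le_essSup _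
        by_contra hy
        have h3 : IsOpen {y | S < ‖g y‖ₑ} := isOpen_lt continuous_const (by fun_prop)
        have h4 := h3.measure_pos volume ⟨y, not_le.1 hy⟩
        refine h4.ne' ?_
        simpa [ae_iff] using h2
      exact ae_of_all _ fun u => h1 _
    calc ∫⁻ u, ‖K u‖ₑ * ‖g (x - t • u)‖ₑ ≤ ∫⁻ u, ‖K u‖ₑ * S := by
          refine lintegral_mono_ae ?_
          filter_upwards [hS] with u hu
          gcongr
      _ = (∫⁻ u, ‖K u‖ₑ) * S := by
          rw [lintegral_mul_const _ (by fun_prop)]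
      _ ≤ (1 * N) * S := by rw [one_mul]; gcongr
      _ ≤ _ := mul_le_mul' (mul_le_mul' hc1 le_rfl) le_rfl
  · have hp0 : p ≠ 0 := (zero_lt_one.trans_le hp).ne'
    have hp1 : 1 ≤ p.toReal := by
      rw [← ENNReal.toReal_one]; exact ENNReal.toReal_mono hpt' hp
    unfold wNorm
    simp only [hpt', if_false]
    set q := p.toReal
    have hq0 : 0 < q := by linarith
    rw [show ∀ X Y : ℝ≥0∞, X ≤ Y ↔ X ^ q ≤ Y ^ q from fun X Y => (ENNReal.rpow_le_rpow_iff hq0).symm,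
      ENNReal.mul_rpow_of_nonneg _ _ hq0.le, ← ENNReal.rpow_mul, ← ENNReal.rpow_mul,
      one_div_mul_cancel hq0.ne', ENNReal.rpow_one, ENNReal.rpow_one]
    -- Jensen
    have hJ : ∀ x, ‖h x‖ₑ ^ q ≤ N ^ (q - 1) * ∫⁻ u, ‖K u‖ₑ * ‖g (x - t • u)‖ₑ ^ q := by
      intro x
      set ν : Measure (Eu n) := volume.withDensity (fun u => ‖K u‖ₑ) with hν
      have hmeas : Continuous (fun u => g (x - t • u)) := by fun_prop
      have h1 := eLpNorm_le_eLpNorm_mul_rpow_measure_univ (μ := ν) hp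
        hmeas.aestronglyMeasurable
      rw [eLpNorm_one_eq_lintegral_enorm, eLpNorm_eq_lintegral_rpow_enorm_toReal hp0 hpt',
        lintegral_withDensity_eq_lintegral_mul₀ (by fun_prop) (by fun_prop),
        lintegral_withDensity_eq_lintegral_mul₀ (by fun_prop) (by fun_prop)] at h1
      have h2 : ν Set.univ ≤ N := by
        rw [hν, withDensity_apply _ MeasurableSet.univ, Measure.restrict_univ]; exact hKN
      calc ‖h x‖ₑ ^ q ≤ ((∫⁻ u, ‖K u‖ₑ * ‖g (x - t • u)‖ₑ ^ q) ^ (1 / q)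
              * N ^ (1 - 1/q)) ^ q := by
            refine ENNReal.rpow_le_rpow ((hpt x).trans (h1.trans ?_)) hq0.le
            simp only [ENNReal.toReal_one, div_one]
            refine mul_le_mul le_rfl (ENNReal.rpow_le_rpow h2 ?_) (by simp) (by simp)
            have : 1 / q ≤ 1 := by rw [div_le_one hq0]; exact hp1
            exact sub_nonneg.2 this
        _ = _ := by
            rw [ENNReal.mul_rpow_of_nonneg _ _ hq0.le, ← ENNReal.rpow_mul, ← ENNReal.rpow_mul,
              one_div_mul_cancel hq0.ne', ENNReal.rpow_one, mul_comm]
            congr 2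
            field_simp
    calc ∫⁻ x, (‖h x‖₊ : ℝ≥0∞) ^ q * jweight a x
        ≤ ∫⁻ x, ∫⁻ u, N ^ (q - 1) * (‖K u‖ₑ * ‖g (x - t • u)‖ₑ ^ q * jweight a x) := by
          refine lintegral_mono fun x => ?_
          rw [lintegral_const_mul _ (by fun_prop), lintegral_mul_const _ (by fun_prop), ← mul_assoc]
          exact mul_le_mul' (hJ x) le_rfl
      _ = ∫⁻ u, ∫⁻ x, N ^ (q - 1) * (‖K u‖ₑ * ‖g (x - t • u)‖ₑ ^ q * jweight a x) := by
          refine lintegral_lintegral_swap ?_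
          have := measurable_jweight (n := n) a
          fun_prop
      _ = ∫⁻ u, ∫⁻ y, N ^ (q - 1) * (‖K u‖ₑ * ‖g y‖ₑ ^ q * jweight a (y + t • u)) := by
          refine lintegral_congr fun u => ?_
          rw [← lintegral_add_right_eq_self _ (t • u)]
          simp
      _ ≤ ∫⁻ u, ∫⁻ y, (N ^ (q - 1) * c * (‖K u‖ₑ * jweight a u)) * (‖g y‖ₑ ^ q * jweight a y) := by
          refine lintegral_mono fun u => lintegral_mono fun y => ?_
          calc N ^ (q - 1) * (‖K u‖ₑ * ‖g y‖ₑ ^ q * jweight a (y + t • u))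
              ≤ N ^ (q - 1) * (‖K u‖ₑ * ‖g y‖ₑ ^ q * (c * jweight a u * jweight a y)) := by
                gcongr; exact peetre a ha t ht y u
            _ = _ := by ring
      _ = N ^ (q - 1) * c * N * ∫⁻ y, ‖g y‖ₑ ^ q * jweight a y := by
          have := measurable_jweight (n := n) a
          simp_rw [lintegral_const_mul _ (show Measurable (fun y => ‖g y‖ₑ ^ q * jweight a y) by fun_prop)]
          rw [lintegral_mul_const _ (by fun_prop), lintegral_const_mul _ (by fun_prop)]
      _ ≤ (c * N) ^ q * ∫⁻ y, ‖g y‖ₑ ^ q * jweight a y := by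
          gcongr
          rw [ENNReal.mul_rpow_of_nonneg _ _ hq0.le]
          have e1 : N ^ (q - 1) * N = N ^ q := by
            have e0 := ENNReal.rpow_add_of_nonneg (x := N) (q - 1) 1 (by linarith) zero_le_one
            rw [ENNReal.rpow_one, sub_add_cancel] at e0
            exact e0.symm
          calc N ^ (q - 1) * c * N = c * (N ^ (q - 1) * N) := by ring
            _ = c * N ^ q := by rw [e1]
            _ ≤ c ^ q * N ^ q := by
              gcongr
              conv_lhs => rw [← ENNReal.rpow_one c]
              exact ENNReal.rpow_le_rpow_of_exponent_le hc1 hp1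

open FourierTransform SchwartzMap in
lemma ift_eq {n : ℕ} (m : Eu n → ℂ) (f : 𝓢(Eu n, ℂ))
    (hm : (fun ξ => m ((2 * Real.pi) • ξ)).HasTemperateGrowth) (x : Eu n) :
    ((((2 * Real.pi) ^ n)⁻¹ : ℝ) : ℂ) *
      ∫ ξ, m ξ * FT f ξ * Complex.exp (Complex.I * ((⟪x, ξ⟫ : ℝ) : ℂ)) =
    fourierMultiplierCLM ℂ (fun ξ => m ((2 * Real.pi) • ξ)) f x := by
  have hpi := Real.pi_pos
  have h4 := Measure.integral_comp_smul (volume : Measure (Eu n))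
    (fun ξ => m ξ * FT f ξ * Complex.exp (Complex.I * ((⟪x, ξ⟫ : ℝ) : ℂ))) (2 * Real.pi)
  simp only [finrank_euclideanSpace, Fintype.card_fin] at h4
  rw [abs_of_pos (by positivity), Complex.real_smul] at h4
  rw [← h4, fourierMultiplierCLM_apply, fourierInv_coe, Real.fourierInv_eq']
  refine integral_congr_ae (ae_of_all _ fun ξ => ?_)
  simp only
  rw [smulLeftCLM_apply_apply hm, fourier_coe, Real.fourier_eq', FT]
  simp only [smul_eq_mul]
  rw [mul_comm, inner_smul_right, real_inner_comm]
  congr 1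
  · congr 1
    push_cast; ring
  · congr 1
    refine integral_congr_ae (ae_of_all _ fun v => ?_)
    simp only [inner_smul_right]
    rw [mul_comm]
    congr 2
    push_cast; ring

/-- Bessel symbol in Mathlib normalisation. -/
def besS {n : ℕ} (s : ℝ) (ξ : Eu n) : ℂ := (((1 + ‖(2 * Real.pi) • ξ‖ ^ 2) ^ (s / 2) : ℝ) : ℂ)

lemma tg_smul {n : ℕ} (c : ℝ) : (fun ξ : Eu n => c • ξ).HasTemperateGrowth :=
  (c • ContinuousLinearMap.id ℝ (Eu n)).hasTemperateGrowth

lemma besS_tg {n : ℕ} (s : ℝ) : (besS s : Eu n → ℂ).HasTemperateGrowth :=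
  Function.Complex.hasTemperateGrowth_ofReal.comp ((contDiff_jap (s/2)).comp (tg_smul _))

open SchwartzMap in
lemma Js_eq {n : ℕ} (s : ℝ) (f : 𝓢(Eu n, ℂ)) :
    Js s f = fourierMultiplierCLM ℂ (besS s) f := by
  ext x
  exact ift_eq (fun ξ => (((1 + ‖ξ‖ ^ 2) ^ (s / 2) : ℝ) : ℂ)) f (besS_tg s) x

/-- Derivative symbol. -/
def dS {n : ℕ} (e ξ : Eu n) : ℂ := (2 * Real.pi * Complex.I) * ((⟪ξ, e⟫ : ℝ) : ℂ)

lemma dS_tg {n : ℕ} (e : Eu n) : (dS e).HasTemperateGrowth := by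
  have h : (fun ξ : Eu n => ((⟪ξ, e⟫ : ℝ) : ℂ)).HasTemperateGrowth :=
    Function.Complex.hasTemperateGrowth_ofReal.comp (by fun_prop)
  exact (Function.HasTemperateGrowth.const _).mul h

open SchwartzMap LineDeriv in
lemma fderiv_mult {n : ℕ} (m : Eu n → ℂ) (hm : m.HasTemperateGrowth) (f : 𝓢(Eu n, ℂ)) (e x : Eu n) :
    fderiv ℝ (fourierMultiplierCLM ℂ m f) x e = fourierMultiplierCLM ℂ (dS e * m) f x := by
  have h : (fun ξ : Eu n => ⟪ξ, e⟫).HasTemperateGrowth := by fun_prop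
  have h' : (fun ξ : Eu n => ((⟪ξ, e⟫ : ℝ) : ℂ)).HasTemperateGrowth :=
    Function.Complex.hasTemperateGrowth_ofReal.comp (by fun_prop)
  rw [← lineDerivOp_apply_eq_fderiv, lineDeriv_eq_fourierMultiplierCLM,
    ← fourierMultiplierCLM_ofReal ℂ h]
  have h2 : dS e = (2 * Real.pi * Complex.I) • (fun ξ : Eu n => ((⟪ξ, e⟫ : ℝ) : ℂ)) := rfl
  rw [← fourierMultiplierCLM_fourierMultiplierCLM_apply (dS_tg e) hm, h2,
    fourierMultiplierCLM_smul h']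
  rfl

/-- smooth with bounded support gives temperate growth -/
lemma tg_of_supp {n : ℕ} (χ : Eu n → ℂ) (hχ : ContDiff ℝ (⊤ : ℕ∞) χ) (R : ℝ)
    (hR : ∀ η, R ≤ ‖η‖ → χ η = 0) : HasCompactSupport χ ∧ χ.HasTemperateGrowth := by
  have h : HasCompactSupport χ := by
    refine HasCompactSupport.intro (isCompact_closedBall 0 R) (fun x hx => hR x ?_)
    simp at hx; exact hx.le
  exact ⟨h, h.hasTemperateGrowth hχ⟩

open SchwartzMap in
lemma lemC {n : ℕ} (p : ℝ≥0∞) (hp : 1 ≤ p) (a : ℝ) (ha : 0 ≤ a) (s : ℝ) (e : Eu n)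
    (χ : Eu n → ℂ) (hχ : ContDiff ℝ (⊤ : ℕ∞) χ) (R : ℝ) (hR : ∀ η, R ≤ ‖η‖ → χ η = 0)
    (M : ℝ × Eu n → ℂ) (hM : ContDiff ℝ (⊤ : ℕ∞) M) (hMR : ∀ t η, R ≤ ‖η‖ → M (t, η) = 0)
    (S : Set ℝ) (hS : S ⊆ Set.Ioc 0 1)
    (hMS : ∀ t ∈ S, ∀ η, M (t, η) =
      dS e η * χ η * (((t ^ 2 + ‖(2 * Real.pi) • η‖ ^ 2) ^ (-s / 2) : ℝ) : ℂ)) :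
    ∃ C : ℝ, 0 ≤ C ∧ ∀ t ∈ S, ∀ f : 𝓢(Eu n, ℂ),
      wNorm p a (fourierMultiplierCLM ℂ (dS e * fun ξ => χ (t • ξ)) f) ≤
        ENNReal.ofReal (C * t ^ (s - 1)) * wNorm p a (fourierMultiplierCLM ℂ (besS s) f) := by
  obtain ⟨B, hB0, hB⟩ := kernel_bound M hM R hMR a
  refine ⟨2 ^ (a/2) * B, by positivity, fun t ht f => ?_⟩
  have ht0 : 0 < t := (hS ht).1
  have htI : t ∈ Set.Icc (0:ℝ) 1 := ⟨ht0.le, (hS ht).2⟩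
  have hMt : ContDiff ℝ (⊤ : ℕ∞) (fun η => M (t, η)) := hM.comp (contDiff_const.prodMk contDiff_id)
  obtain ⟨hcs, htg⟩ := tg_of_supp (fun η => M (t, η)) hMt R (hMR t)
  set m : 𝓢(Eu n, ℂ) := hcs.toSchwartzMap hMt with hm
  have hmη : ∀ η, m η = M (t, η) := fun η => rfl
  set μ : Eu n → ℂ := fun ξ => M (t, t • ξ) with hμ
  have hμt : μ.HasTemperateGrowth := htg.comp (tg_smul t)
  have hχt : (fun ξ => χ (t • ξ)).HasTemperateGrowth := (tg_of_supp χ hχ R hR).2.comp (tg_smul t)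
  set g := fourierMultiplierCLM ℂ (besS s) f with hg
  have key : (dS e * fun ξ => χ (t • ξ)) = (((t ^ (s - 1) : ℝ) : ℂ) • μ) * besS s := by
    ext ξ
    simp only [Pi.mul_apply, Pi.smul_apply, smul_eq_mul, hμ]
    rw [hMS t ht]
    have e1 : dS e (t • ξ) = t * dS e ξ := by
      simp only [dS, inner_smul_left]; push_cast; simp; ring
    have e2 : (t ^ 2 + ‖(2 * Real.pi) • t • ξ‖ ^ 2) ^ (-s/2)
        = t ^ (-s) * (1 + ‖(2 * Real.pi) • ξ‖ ^ 2) ^ (-s/2) := by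
      rw [smul_comm, norm_smul t, Real.norm_of_nonneg ht0.le]
      rw [show t ^ 2 + (t * ‖(2 * Real.pi) • ξ‖) ^ 2 = t ^ 2 * (1 + ‖(2 * Real.pi) • ξ‖ ^ 2) by ring,
        Real.mul_rpow (by positivity) (by positivity), ← Real.rpow_natCast t 2, ← Real.rpow_mul ht0.le]
      congr 2
      push_cast; ring
    have e3 : (1 + ‖(2 * Real.pi) • ξ‖ ^ 2) ^ (-s/2) * (1 + ‖(2 * Real.pi) • ξ‖ ^ 2) ^ (s/2) = 1 := by
      rw [← Real.rpow_add (by positivity)]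
      rw [show -s/2 + s/2 = 0 by ring, Real.rpow_zero]
    have e4 : t ^ (s - 1) * t * t ^ (-s) = 1 := by
      nth_rewrite 2 [← Real.rpow_one t]
      rw [← Real.rpow_add ht0, ← Real.rpow_add ht0]
      rw [show s - 1 + 1 + -s = 0 by ring, Real.rpow_zero]
    rw [e1, e2, besS]
    have e5 : ((t ^ (s - 1) * t * t ^ (-s) * ((1 + ‖(2 * Real.pi) • ξ‖ ^ 2) ^ (-s/2)
      * (1 + ‖(2 * Real.pi) • ξ‖ ^ 2) ^ (s/2)) : ℝ) : ℂ) = 1 := by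
      rw [e3, e4]; simp
    push_cast at e5 ⊢
    calc dS e ξ * χ (t • ξ) = dS e ξ * χ (t • ξ) * 1 := by ring
      _ = _ := by rw [← e5]; ring
  have h1 : fourierMultiplierCLM ℂ (dS e * fun ξ => χ (t • ξ)) f
      = ((t ^ (s - 1) : ℝ) : ℂ) • fourierMultiplierCLM ℂ μ g := by
    have htg' : (((t ^ (s - 1) : ℝ) : ℂ) • μ).HasTemperateGrowth :=
      (Function.HasTemperateGrowth.const ((t ^ (s - 1) : ℝ) : ℂ)).mul hμt
    rw [key, ← fourierMultiplierCLM_fourierMultiplierCLM_apply htg' (besS_tg s),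
      fourierMultiplierCLM_smul hμt]
    rfl
  set c : ℝ := t ^ (s - 1) with hc
  have hc0 : 0 ≤ c := by positivity
  have h2 := conv_bound p hp a ha _ g (fourierMultiplierCLM ℂ μ g)
    (SchwartzMap.continuous _) (SchwartzMap.continuous _) t htI ht0
    (fun x => mult_eq_conv m g μ hμt t ht0 (fun ξ => rfl) x)
  rw [h1]
  rw [wNorm_eq p hp a ha _ (SchwartzMap.continuous _).aestronglyMeasurable] at h2 ⊢
  have h3 : eLpNorm ((c : ℂ) • fourierMultiplierCLM ℂ μ g) p (volume.withDensity (jweight a))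
      = ENNReal.ofReal c * eLpNorm (fourierMultiplierCLM ℂ μ g) p (volume.withDensity (jweight a)) := by
    have := eLpNorm_const_smul (c : ℂ) (fourierMultiplierCLM ℂ μ g) p
      (volume.withDensity (jweight (n := n) a))
    rw [← ofReal_norm, Complex.norm_real, Real.norm_of_nonneg hc0] at this
    exact this
  rw [h3]
  calc _ ≤ ENNReal.ofReal c * (ENNReal.ofReal (2 ^ (a/2)) * ENNReal.ofReal B * wNorm p a g) := by
        gcongr
        refine h2.trans ?_
        gcongr
        exact hB t htI m hmη
    _ = _ := by
        rw [ENNReal.ofReal_mul (by positivity), ENNReal.ofReal_mul (by positivity)]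
        ring

/-- Data needed on the cutoff. -/
def GoodCut {n : ℕ} (e : Eu n) (χ : Eu n → ℂ) (R : ℝ) (S : Set ℝ) : Prop :=
  ∀ s : ℝ, ∃ M : ℝ × Eu n → ℂ, ContDiff ℝ (⊤ : ℕ∞) M ∧ (∀ t η, R ≤ ‖η‖ → M (t, η) = 0) ∧
    ∀ t ∈ S, ∀ η, M (t, η) =
      dS e η * χ η * (((t ^ 2 + ‖(2 * Real.pi) • η‖ ^ 2) ^ (-s / 2) : ℝ) : ℂ)

lemma dS_smooth {n : ℕ} (e : Eu n) : ContDiff ℝ (⊤ : ℕ∞) (dS e) := (dS_tg e).1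

lemma good_low {n : ℕ} (e : Eu n) (χ : Eu n → ℂ) (hχ : ContDiff ℝ (⊤ : ℕ∞) χ) (R : ℝ)
    (hR : ∀ η, R ≤ ‖η‖ → χ η = 0) : GoodCut e χ R {1} := by
  intro s
  refine ⟨fun z => dS e z.2 * χ z.2 * besS (-s) z.2, ?_, ?_, ?_⟩
  · have h : ContDiff ℝ (⊤ : ℕ∞) (fun η => dS e η * χ η * besS (-s) η) :=
      ((dS_smooth e).mul hχ).mul (besS_tg (-s)).1
    exact h.comp contDiff_snd
  · intro t η h; simp [hR η h]
  · intro t ht η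
    rw [Set.mem_singleton_iff.1 ht]
    simp [besS]

lemma good_high {n : ℕ} (e : Eu n) (χ : Eu n → ℂ) (hχ : ContDiff ℝ (⊤ : ℕ∞) χ) (R ρ : ℝ)
    (hR : ∀ η, R ≤ ‖η‖ → χ η = 0) (hρ : 0 < ρ) (hρ' : ∀ η, ‖η‖ < ρ → χ η = 0) (S : Set ℝ) :
    GoodCut e χ R S := by
  intro s
  refine ⟨fun z => dS e z.2 * χ z.2 *
    (((z.1 ^ 2 + ‖(2 * Real.pi) • z.2‖ ^ 2) ^ (-s / 2) : ℝ) : ℂ), ?_, ?_, ?_⟩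
  · rw [contDiff_iff_contDiffAt]
    intro z
    by_cases hz : z.2 = 0
    · have : (fun z : ℝ × Eu n => dS e z.2 * χ z.2 *
          (((z.1 ^ 2 + ‖(2 * Real.pi) • z.2‖ ^ 2) ^ (-s / 2) : ℝ) : ℂ)) =ᶠ[nhds z] fun _ => 0 := by
        have hop : IsOpen {z : ℝ × Eu n | ‖z.2‖ < ρ} := isOpen_lt (by fun_prop) continuous_const
        filter_upwards [hop.mem_nhds (show ‖z.2‖ < ρ by simpa [hz] using hρ)] with w hw
        simp [hρ' w.2 hw]
      exact contDiffAt_const.congr_of_eventuallyEq this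
    · refine ContDiffAt.mul ?_ ?_
      · exact (((dS_smooth e).mul hχ).comp contDiff_snd).contDiffAt
      · refine Complex.ofRealCLM.contDiff.contDiffAt.comp z ?_
        refine ContDiffAt.rpow_const_of_ne ?_ ?_
        · refine ContDiff.contDiffAt ?_
          exact (contDiff_fst.pow 2).add ((contDiff_snd.const_smul (2 * Real.pi)).norm_sq ℝ)
        · have : 0 < ‖(2 * Real.pi) • z.2‖ := by
            rw [norm_pos_iff]
            exact smul_ne_zero (by positivity) hz
          positivity
  · intro t η h; simp [hR η h]
  · intro t ht η; rfl

open SchwartzMap in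
lemma lemD {n : ℕ} (p : ℝ≥0∞) (hp : 1 ≤ p) (a : ℝ) (ha : 0 ≤ a) (s : ℝ) (hs : 0 < s)
    (ε : ℝ) (hε0 : 0 ≤ ε) (hεs : ε < s) (e : Eu n)
    (χ : Eu n → ℂ) (hχ : ContDiff ℝ (⊤ : ℕ∞) χ) (R : ℝ) (hR : ∀ η, R ≤ ‖η‖ → χ η = 0)
    (S : Set ℝ) (hS : S ⊆ Set.Ioc 0 1) (hG : GoodCut e χ R S) :
    ∃ C : ℝ, 0 ≤ C ∧ ∀ t ∈ S, ∀ f : 𝓢(Eu n, ℂ),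
      wNorm p a (fourierMultiplierCLM ℂ (dS e * fun ξ => χ (t • ξ)) f) ≤
        ENNReal.ofReal (C * t ^ (ε - 1)) * (wNorm p a f ^ (1 - ε / s) *
          wNorm p a (Js s f) ^ (ε / s)) := by
  obtain ⟨M0, h01, h02, h03⟩ := hG 0
  obtain ⟨M1, h11, h12, h13⟩ := hG s
  obtain ⟨C0, hC0, H0⟩ := lemC p hp a ha 0 e χ hχ R hR M0 h01 h02 S hS h03
  obtain ⟨C1, hC1, H1⟩ := lemC p hp a ha s e χ hχ R hR M1 h11 h12 S hS h13
  set C := max (max C0 C1) 1 with hC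
  have hC0' : C0 ≤ C := (le_max_left _ _).trans (le_max_left _ _)
  have hC1' : C1 ≤ C := (le_max_right _ _).trans (le_max_left _ _)
  have hCpos : 0 < C := zero_lt_one.trans_le (le_max_right _ _)
  refine ⟨C, hCpos.le, fun t ht f => ?_⟩
  have ht0 : 0 < t := (hS ht).1
  set X := wNorm p a (fourierMultiplierCLM ℂ (dS e * fun ξ => χ (t • ξ)) f) with hX
  have hb0 : fourierMultiplierCLM ℂ (besS 0) f = f := by
    have : (besS 0 : Eu n → ℂ) = fun _ => 1 := by ext ξ; simp [besS]
    rw [this, fourierMultiplierCLM_const]; simp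
  have X0 : X ≤ ENNReal.ofReal (C * t ^ (0 - 1 : ℝ)) * wNorm p a f := by
    have := H0 t ht f
    rw [hb0] at this
    refine this.trans ?_
    gcongr
  have X1 : X ≤ ENNReal.ofReal (C * t ^ (s - 1 : ℝ)) * wNorm p a (Js s f) := by
    rw [Js_eq]
    refine (H1 t ht f).trans ?_
    gcongr
  set θ := ε / s with hθ
  have hθ0 : 0 ≤ θ := by positivity
  have hθ1 : 0 ≤ 1 - θ := by
    rw [sub_nonneg, hθ, div_le_one hs]; exact hεs.le
  have hθs : s * θ = ε := by rw [hθ]; field_simp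
  have e0 := ENNReal.rpow_add_of_nonneg (x := X) (1 - θ) θ hθ1 hθ0
  rw [sub_add_cancel, ENNReal.rpow_one] at e0
  rw [e0]
  refine (mul_le_mul' (ENNReal.rpow_le_rpow X0 hθ1) (ENNReal.rpow_le_rpow X1 hθ0)).trans (le_of_eq ?_)
  rw [ENNReal.mul_rpow_of_nonneg _ _ hθ1, ENNReal.mul_rpow_of_nonneg _ _ hθ0,
    ENNReal.ofReal_rpow_of_pos (by positivity), ENNReal.ofReal_rpow_of_pos (by positivity)]
  have e1 : (C * t ^ (0 - 1 : ℝ)) ^ (1 - θ) * (C * t ^ (s - 1)) ^ θ = C * t ^ (ε - 1) := by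
    rw [Real.mul_rpow hCpos.le (by positivity), Real.mul_rpow hCpos.le (by positivity),
      ← Real.rpow_mul ht0.le, ← Real.rpow_mul ht0.le]
    have e2 : C ^ (1 - θ) * C ^ θ = C := by
      rw [← Real.rpow_add hCpos]; simp
    have e3 : t ^ ((0 - 1) * (1 - θ)) * t ^ ((s - 1) * θ) = t ^ (ε - 1) := by
      rw [← Real.rpow_add ht0, ← hθs]; congr 1; ring
    calc _ = (C ^ (1 - θ) * C ^ θ) * (t ^ ((0 - 1) * (1 - θ)) * t ^ ((s - 1) * θ)) := by ring
      _ = _ := by rw [e2, e3]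
  rw [← e1, ENNReal.ofReal_mul (by positivity)]
  ring

open SchwartzMap in
lemma lemE {n : ℕ} (p : ℝ≥0∞) (hp : 1 ≤ p) (a : ℝ) (ha : 0 ≤ a) (s : ℝ) (hs : 0 < s)
    (ε : ℝ) (hε0 : 0 ≤ ε) (hεs : ε < s) (hε1 : ε < 1) (e : Eu n)
    (φ : Eu n → ℂ) (hφ : ContDiff ℝ (⊤ : ℕ∞) φ) (R ρ : ℝ) (hR0 : 0 ≤ R) (hR : ∀ η, R ≤ ‖η‖ → φ η = 0)
    (hρ : 0 < ρ) (hφ1 : ∀ η, ‖η‖ ≤ ρ → φ η = 1) :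
    ∃ C : ℝ, 0 ≤ C ∧ ∀ k : ℕ, ∀ f : 𝓢(Eu n, ℂ),
      wNorm p a (fourierMultiplierCLM ℂ (dS e * fun ξ => φ (((2:ℝ)⁻¹ ^ k) • ξ)) f) ≤
        ENNReal.ofReal (C * 2 ^ ((k:ℝ) * (1 - ε))) * (wNorm p a f ^ (1 - ε / s) *
          wNorm p a (Js s f) ^ (ε / s)) := by
  set ψ : Eu n → ℂ := fun η => φ η - φ ((2:ℝ) • η) with hψ
  have hψs : ContDiff ℝ (⊤ : ℕ∞) ψ := hφ.sub (hφ.comp (contDiff_id.const_smul (2:ℝ)))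
  have hψR : ∀ η, R ≤ ‖η‖ → ψ η = 0 := by
    intro η h
    simp only [hψ]
    rw [hR η h, hR _ (by rw [norm_smul]; simp; linarith), sub_zero]
  have hψρ : ∀ η, ‖η‖ < ρ / 2 → ψ η = 0 := by
    intro η h
    simp only [hψ]
    rw [hφ1 η (by linarith), hφ1 _ (by rw [norm_smul]; simp; linarith), sub_self]
  obtain ⟨C0, hC0, H0⟩ := lemD p hp a ha s hs ε hε0 hεs e φ hφ R hR {1} (by simp)
    (good_low e φ hφ R hR)
  obtain ⟨C1, hC1, H1⟩ := lemD p hp a ha s hs ε hε0 hεs e ψ hψs R hψR (Set.Ioc 0 1) le_rfl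
    (good_high e ψ hψs R (ρ/2) hψR (by positivity) hψρ _)
  set r : ℝ := 2 ^ (1 - ε) with hr
  have hr1 : 1 < r := Real.one_lt_rpow (by norm_num) (by linarith)
  have hrk : ∀ k : ℕ, (2:ℝ) ^ ((k:ℝ) * (1 - ε)) = r ^ k := by
    intro k
    rw [hr, ← Real.rpow_natCast, ← Real.rpow_mul (by norm_num), mul_comm]
  have hrk' : ∀ k : ℕ, ((2:ℝ)⁻¹ ^ k) ^ (ε - 1) = r ^ k := by
    intro k
    rw [← hrk, ← Real.rpow_natCast, ← Real.rpow_mul (by norm_num), Real.inv_rpow (by norm_num),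
      ← Real.rpow_neg (by norm_num)]
    congr 1; ring
  have hφt : ∀ t : ℝ, (fun ξ => φ (t • ξ)).HasTemperateGrowth := fun t =>
    (tg_of_supp φ hφ R hR).2.comp (tg_smul t)
  have hψt : ∀ t : ℝ, (fun ξ => ψ (t • ξ)).HasTemperateGrowth := fun t =>
    (tg_of_supp ψ hψs R hψR).2.comp (tg_smul t)
  have hr10 : 0 < r - 1 := by linarith
  refine ⟨C0 + C1 * r / (r - 1), by positivity, fun k f => ?_⟩
  set C := C0 + C1 * r / (r - 1) with hC
  have hCpos : 0 ≤ C := by positivity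
  set Q := wNorm p a f ^ (1 - ε / s) * wNorm p a (Js s f) ^ (ε / s) with hQ
  rw [hrk]
  induction k with
  | zero =>
    have := H0 1 rfl f
    simp only [Real.one_rpow, mul_one] at this
    simp only [pow_zero, mul_one]
    refine this.trans ?_
    gcongr
    rw [hC]
    have : 0 ≤ C1 * r / (r - 1) := by positivity
    linarith
  | succ k ih =>
    have hmem : ((2:ℝ)⁻¹ ^ (k+1)) ∈ Set.Ioc (0:ℝ) 1 :=
      ⟨by positivity, pow_le_one₀ (by norm_num) (by norm_num)⟩
    have h1 := H1 _ hmem f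
    rw [hrk'] at h1
    have hdec : (dS e * fun ξ => φ (((2:ℝ)⁻¹ ^ (k+1)) • ξ)) =
        fun ξ => (dS e * fun ξ => φ (((2:ℝ)⁻¹ ^ k) • ξ)) ξ
          + (dS e * fun ξ => ψ (((2:ℝ)⁻¹ ^ (k+1)) • ξ)) ξ := by
      ext ξ
      simp only [Pi.mul_apply, hψ, smul_smul]
      rw [show (2:ℝ) * 2⁻¹ ^ (k+1) = 2⁻¹ ^ k by rw [pow_succ]; ring]
      ring
    have hsum : fourierMultiplierCLM ℂ (dS e * fun ξ => φ (((2:ℝ)⁻¹ ^ (k+1)) • ξ)) f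
        = fourierMultiplierCLM ℂ (dS e * fun ξ => φ (((2:ℝ)⁻¹ ^ k) • ξ)) f
          + fourierMultiplierCLM ℂ (dS e * fun ξ => ψ (((2:ℝ)⁻¹ ^ (k+1)) • ξ)) f := by
      have := smulLeftCLM_add (F := ℂ) ((dS_tg e).mul (hφt (2⁻¹ ^ k)))
        ((dS_tg e).mul (hψt (2⁻¹ ^ (k+1))))
      rw [hdec]
      simp only [fourierMultiplierCLM_apply]
      rw [show (fun ξ => (dS e * fun ξ => φ (((2:ℝ)⁻¹ ^ k) • ξ)) ξ
          + (dS e * fun ξ => ψ (((2:ℝ)⁻¹ ^ (k+1)) • ξ)) ξ) = (dS e * fun ξ => φ (((2:ℝ)⁻¹ ^ k) • ξ))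
          + (dS e * fun ξ => ψ (((2:ℝ)⁻¹ ^ (k+1)) • ξ)) from rfl, this, add_apply,
          FourierTransform.fourierInv_add]
    have hm : ∀ F : 𝓢(Eu n, ℂ), AEStronglyMeasurable F (volume.withDensity (jweight (n := n) a)) :=
      fun F => F.continuous.aestronglyMeasurable
    rw [hsum]
    rw [wNorm_eq p hp a ha _ (SchwartzMap.continuous _).aestronglyMeasurable] at ih h1 ⊢
    refine (eLpNorm_add_le (hm _) (hm _) hp).trans ?_
    refine (add_le_add ih h1).trans ?_
    rw [← add_mul, ← ENNReal.ofReal_add (by positivity) (by positivity)]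
    gcongr
    have h5 : C + C1 * r ≤ C * r := by
      have : C1 * r / (r - 1) * (r - 1) = C1 * r := by field_simp
      have h6 : 0 ≤ C0 * (r - 1) := by positivity
      nlinarith
    calc C * r ^ k + C1 * r ^ (k+1) = (C + C1 * r) * r ^ k := by ring
      _ ≤ (C * r) * r ^ k := by gcongr
      _ = _ := by ring

/-- **Weighted Bernstein inequality, interpolated gradient bound** (Lemma 3.3 (iv)). -/
theorem weighted_bernstein_gradient (n : ℕ) (hn : 1 ≤ n) (s : ℝ) (hs : 0 < s)
    (p : ℝ≥0∞) (hp : 1 ≤ p) (a : ℝ) (ha : 0 ≤ a) (ε : ℝ) (hε0 : 0 ≤ ε)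
    (hε : ε < min 1 s) (Φ : Eu n → ℝ) (hΦ : IsLPBump Φ) :
    ∃ C : ℝ, 0 < C ∧ ∀ k : ℕ, ∀ f : SchwartzMap (Eu n) ℂ,
      wNorm p a (gradNorm (SProj Φ (k : ℤ) ⇑f)) ≤
        ENNReal.ofReal (C * 2 ^ ((k : ℝ) * (1 - ε))) *
          wNorm p a ⇑f ^ (1 - ε / s) * wNorm p a (Js s ⇑f) ^ (ε / s) := by
  have hpi := Real.pi_pos
  obtain ⟨hΦs, -, hΦ1, hΦ2⟩ := hΦ
  set φ : Eu n → ℂ := fun η => ((Φ ((2 * Real.pi) • η) : ℝ) : ℂ) with hφ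
  have hφs : ContDiff ℝ (⊤ : ℕ∞) φ :=
    Complex.ofRealCLM.contDiff.comp (hΦs.comp (contDiff_id.const_smul (2 * Real.pi)))
  have hnorm : ∀ η : Eu n, ‖(2 * Real.pi) • η‖ = 2 * Real.pi * ‖η‖ := by
    intro η; rw [norm_smul, Real.norm_of_nonneg (by positivity)]
  have hφR : ∀ η, 1 / Real.pi ≤ ‖η‖ → φ η = 0 := by
    intro η h
    simp only [hφ]
    rw [hΦ2]; · simp
    rw [hnorm]
    rw [div_le_iff₀ hpi] at h
    linarith
  have hφ1 : ∀ η, ‖η‖ ≤ 1 / (2 * Real.pi) → φ η = 1 := by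
    intro η h
    simp only [hφ]
    rw [hΦ1]; · simp
    rw [hnorm]
    rw [le_div_iff₀ (by positivity)] at h
    linarith
  have hφt : ∀ t : ℝ, (fun ξ => φ (t • ξ)).HasTemperateGrowth := fun t =>
    (tg_of_supp φ hφs _ hφR).2.comp (tg_smul t)
  have hmain : ∀ l : Fin n, _ := fun l => lemE p hp a ha s hs ε hε0
    (hε.trans_le (min_le_right _ _)) (hε.trans_le (min_le_left _ _)) (EuclideanSpace.single l (1:ℝ))
    φ hφs (1 / Real.pi) (1 / (2 * Real.pi)) (by positivity) hφR (by positivity) hφ1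
  choose C hC0 hC using hmain
  have hCs : 0 ≤ ∑ l, C l := Finset.sum_nonneg fun l _ => hC0 l
  refine ⟨∑ l, C l + 1, by positivity, fun k f => ?_⟩
  have hS : SProj Φ (k:ℤ) f = SchwartzMap.fourierMultiplierCLM ℂ (fun ξ => φ (((2:ℝ)⁻¹ ^ k) • ξ)) f := by
    have hfun : (fun ξ : Eu n => ((Φ ((2:ℝ) ^ (-(k:ℤ)) • ((2 * Real.pi) • ξ)) : ℝ) : ℂ))
        = fun ξ => φ (((2:ℝ)⁻¹ ^ k) • ξ) := by
      ext ξ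
      simp only [hφ]
      rw [smul_comm, zpow_neg, zpow_natCast, inv_pow]
    ext x
    have := ift_eq (fun ξ => ((Φ ((2:ℝ) ^ (-(k:ℤ)) • ξ) : ℝ) : ℂ)) f (by rw [hfun]; exact hφt _) x
    rw [hfun] at this
    exact this
  set X : Fin n → SchwartzMap (Eu n) ℂ := fun l => SchwartzMap.fourierMultiplierCLM ℂ
    (dS (EuclideanSpace.single l (1:ℝ)) * fun ξ => φ (((2:ℝ)⁻¹ ^ k) • ξ)) f with hX
  have hgrad : gradNorm (SProj Φ (k:ℤ) f) = fun x => Real.sqrt (∑ l, ‖X l x‖ ^ 2) := by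
    ext x
    rw [hS, gradNorm]
    congr 1
    refine Finset.sum_congr rfl fun l _ => ?_
    rw [fderiv_mult _ (hφt _)]
  have hcont : Continuous (fun x => Real.sqrt (∑ l, ‖X l x‖ ^ 2)) := by
    refine Real.continuous_sqrt.comp (continuous_finsetSum _ fun l _ => ?_)
    exact ((X l).continuous.norm).pow 2
  rw [hgrad, wNorm_eq p hp a ha _ hcont.aestronglyMeasurable]
  set ν := (volume : Measure (Eu n)).withDensity (jweight a)
  set Q := wNorm p a f ^ (1 - ε / s) * wNorm p a (Js s f) ^ (ε / s) with hQ
  calc eLpNorm (fun x => Real.sqrt (∑ l, ‖X l x‖ ^ 2)) p ν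
      ≤ eLpNorm (∑ l, fun x => ‖X l x‖) p ν := by
        refine eLpNorm_mono_real fun x => ?_
        rw [Real.norm_of_nonneg (Real.sqrt_nonneg _), Finset.sum_apply]
        refine Real.sqrt_le_iff.2 ⟨Finset.sum_nonneg fun l _ => norm_nonneg _, ?_⟩
        exact Finset.sum_sq_le_sq_sum_of_nonneg fun l _ => norm_nonneg _
    _ ≤ ∑ l, eLpNorm (fun x => ‖X l x‖) p ν :=
        eLpNorm_sum_le (fun l _ => (X l).continuous.norm.aestronglyMeasurable) hp
    _ ≤ ∑ l, ENNReal.ofReal (C l * 2 ^ ((k:ℝ) * (1 - ε))) * Q := by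
        refine Finset.sum_le_sum fun l _ => ?_
        rw [eLpNorm_norm, ← wNorm_eq p hp a ha _ (X l).continuous.aestronglyMeasurable]
        exact hC l k f
    _ = ENNReal.ofReal ((∑ l, C l) * 2 ^ ((k:ℝ) * (1 - ε))) * Q := by
        rw [← Finset.sum_mul, Finset.sum_mul (f := C), ENNReal.ofReal_sum_of_nonneg]
        exact fun l _ => mul_nonneg (hC0 l) (by positivity)
    _ ≤ _ := by
        rw [mul_assoc, ← hQ]
        gcongr
        linarith
end
end
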